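/- arXiv:1011.1186 — 2 statements merged into one kernel-verified Lean document; each statement's English description precedes it below -/
import Mathlib

section
/- Let r > 0, set q = e^{−π√r}, assume k_r ∈ (0,1) satisfies K(√(1 − k_r²)) = √r · K(k_r), and let k'_r = √(1 − k_r²). Then for every positive integer ν, the continued fraction u(q^ν, q) converges, u(q^ν,q) ≠ 1, and −1 + 2/(1 − u(q^ν, q)) = (π/(2·k'_r·K(k_r)))·exp(−4·∑_{j=1}^{ν−1} arctanh(q^j)), where the finite sum is empty (equal to 0) when ν = 1. -/
open Filter

/-- Numerator pairs `(p_{n-1}, p_n)` of the continued fraction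
`c 1 / (b 1 + c 2 / (b 2 + ⋯))` (indices start at 1). -/
noncomputable def cfNum (c b : ℕ → ℝ) : ℕ → ℝ × ℝ
  | 0 => (1, 0)
  | n + 1 => ((cfNum c b n).2, b (n + 1) * (cfNum c b n).2 + c (n + 1) * (cfNum c b n).1)

/-- Denominator pairs `(q_{n-1}, q_n)` of the continued fraction. -/
noncomputable def cfDen (c b : ℕ → ℝ) : ℕ → ℝ × ℝ
  | 0 => (0, 1)
  | n + 1 => ((cfDen c b n).2, b (n + 1) * (cfDen c b n).2 + c (n + 1) * (cfDen c b n).1)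

/-- The continued fraction with partial numerators `c` and partial denominators `b`
(both indexed from 1) converges to `L`, i.e. its convergents tend to `L`. -/
def CFTendsto (c b : ℕ → ℝ) (L : ℝ) : Prop :=
  Tendsto (fun n => (cfNum c b n).2 / (cfDen c b n).2) atTop (nhds L)
/-- The complete elliptic integral of the first kind
`K(x) = ∫₀^{π/2} dt / √(1 - x² sin² t)`. -/
noncomputable def Kint (x : ℝ) : ℝ :=
  ∫ t in (0 : ℝ)..(Real.pi / 2), 1 / Real.sqrt (1 - x ^ 2 * Real.sin t ^ 2)
/-- The inverse hyperbolic tangent. -/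
noncomputable def arctanh (x : ℝ) : ℝ := Real.log ((1 + x) / (1 - x)) / 2

section PartA

/-- error product -/
noncomputable def cfErr (c b : ℕ → ℝ) : ℕ → ℝ
  | 0 => c 1 / b 1
  | n + 1 => cfErr c b n * (c (n + 2) / (b (n + 1) * b (n + 2)))

theorem cf_den_ge (c b : ℕ → ℝ) (hc : ∀ n, 0 < c (n + 1)) (hb : ∀ n, 0 < b (n + 1)) (n : ℕ) :
    0 ≤ (cfDen c b n).1 ∧ ∏ i ∈ Finset.range n, b (i + 1) ≤ (cfDen c b n).2 := by
  induction n with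
  | zero => simp [cfDen]
  | succ n ih =>
    obtain ⟨h1, h2⟩ := ih
    have hp : 0 < ∏ i ∈ Finset.range n, b (i + 1) := Finset.prod_pos fun i _ => hb i
    refine ⟨by simp only [cfDen]; linarith, ?_⟩
    simp only [cfDen]
    rw [Finset.prod_range_succ]
    have := mul_nonneg (hc n).le h1
    nlinarith [hb n, mul_le_mul_of_nonneg_left h2 (hb n).le]

theorem cf_resid (c b φ : ℕ → ℝ) (hb : ∀ n, 0 < b (n + 1))
    (hrec : ∀ n, φ n = φ (n + 1) + c (n + 2) / (b (n + 1) * b (n + 2)) * φ (n + 2)) (n : ℕ) :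
    ((cfNum c b (n+1)).1 * φ 0 - (cfDen c b (n+1)).1 * (c 1 / b 1 * φ 1) =
      (-1) ^ (n + 1) * (cfErr c b n * ∏ i ∈ Finset.range n, b (i + 1)) * φ (n + 1)) ∧
    ((cfNum c b (n+1)).2 * φ 0 - (cfDen c b (n+1)).2 * (c 1 / b 1 * φ 1) =
      (-1) ^ n * (cfErr c b (n+1) * ∏ i ∈ Finset.range (n+1), b (i + 1)) * φ (n + 2)) := by
  induction n with
  | zero =>
    have h1 := (hb 0).ne'
    have h2 := (hb 1).ne'
    have h := hrec 0
    simp only [zero_add, Nat.reduceAdd] at h h1 h2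
    constructor
    · simp [cfNum, cfDen, cfErr]
    · simp [cfNum, cfDen, cfErr]
      rw [h]
      field_simp
      ring
  | succ n ih =>
    obtain ⟨i1, i2⟩ := ih
    constructor
    · rw [show (cfNum c b (n+1+1)).1 = (cfNum c b (n+1)).2 from rfl,
        show (cfDen c b (n+1+1)).1 = (cfDen c b (n+1)).2 from rfl, i2]
      ring
    · rw [show (cfNum c b (n+1+1)).2 = b (n+1+1) * (cfNum c b (n+1)).2 + c (n+1+1) * (cfNum c b (n+1)).1 from rfl,
        show (cfDen c b (n+1+1)).2 = b (n+1+1) * (cfDen c b (n+1)).2 + c (n+1+1) * (cfDen c b (n+1)).1 from rfl]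
      have : ∀ x y z w B C P Q: ℝ, (B * x + C * y) * P - (B * z + C * w) * Q =
        B * (x * P - z * Q) + C * (y * P - w * Q) := by intros; ring
      rw [this, i1, i2, hrec (n+1)]
      have h1 := (hb n).ne'
      have h2 := (hb (n+1)).ne'
      have h3 := (hb (n+2)).ne'
      simp only [cfErr, Finset.prod_range_succ]
      simp only [add_assoc, Nat.reduceAdd] at *
      field_simp
      ring

theorem cf_tendsto (c b φ : ℕ → ℝ) (hc : ∀ n, 0 < c (n + 1)) (hb : ∀ n, 0 < b (n + 1))
    (hφ : ∀ n, 0 < φ n)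
    (hrec : ∀ n, φ n = φ (n + 1) + c (n + 2) / (b (n + 1) * b (n + 2)) * φ (n + 2))
    (hlim : Tendsto (fun n => c (n + 2) / (b (n + 1) * b (n + 2))) atTop (nhds 0)) :
    CFTendsto c b (c 1 / b 1 * φ 1 / φ 0) := by
  have hE : ∀ n, 0 < cfErr c b n := by
    intro n
    induction n with
    | zero => exact div_pos (hc 0) (hb 0)
    | succ n ih => exact mul_pos ih (div_pos (hc _) (mul_pos (hb _) (hb _)))
  have hE0 : Tendsto (cfErr c b) atTop (nhds 0) := by
    apply Summable.tendsto_atTop_zero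
    apply summable_of_ratio_test_tendsto_lt_one (l := 0) one_pos
    · exact Eventually.of_forall fun n => (hE n).ne'
    · refine hlim.congr fun n => ?_
      have := hE n
      rw [Real.norm_of_nonneg (hE _).le, Real.norm_of_nonneg (hE _).le]
      simp only [cfErr]
      field_simp
  have hφ1 : ∀ n, φ n ≤ φ 0 := by
    intro n
    induction n with
    | zero => exact le_rfl
    | succ n ih =>
      have := hrec n
      have h2 := mul_pos (div_pos (hc (n+1)) (mul_pos (hb n) (hb (n+1)))) (hφ (n+2))
      simp only [add_assoc, Nat.reduceAdd] at *
      linarith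
  unfold CFTendsto
  rw [← tendsto_add_atTop_iff_nat 1]
  rw [tendsto_iff_norm_sub_tendsto_zero]
  refine squeeze_zero (fun n => norm_nonneg _) (fun n => ?_) ((tendsto_add_atTop_iff_nat 1).2 hE0)
  have hp : 0 < ∏ i ∈ Finset.range (n+1), b (i + 1) := Finset.prod_pos fun i _ => hb i
  have hd := (cf_den_ge c b hc hb (n+1)).2
  have hd0 := hp.trans_le hd
  have h0 := hφ 0
  have e : (cfNum c b (n+1)).2 / (cfDen c b (n+1)).2 - c 1 / b 1 * φ 1 / φ 0 =
     ((-1) ^ n * (cfErr c b (n+1) * ∏ i ∈ Finset.range (n+1), b (i + 1)) * φ (n + 2)) /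
      ((cfDen c b (n+1)).2 * φ 0) := by
    rw [← (cf_resid c b φ hb hrec n).2, div_sub_div _ _ hd0.ne' h0.ne']
  rw [e, Real.norm_eq_abs, abs_div, abs_mul, abs_mul, abs_pow, abs_neg, abs_one, one_pow, one_mul,
    abs_of_pos (mul_pos hd0 h0), abs_of_pos (hφ _), abs_of_pos (mul_pos (hE _) hp),
    div_le_iff₀ (mul_pos hd0 h0)]
  calc _ ≤ cfErr c b (n + 1) * (cfDen c b (n + 1)).2 * φ 0 := by
        gcongr
        · exact (hφ _).le
        · exact mul_nonneg (hE _).le hd0.le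
        · exact (hE _).le
        · exact hφ1 _
    _ = _ := by ring

/-- coefficients -/
noncomputable def tco (q : ℝ) (n : ℕ) : ℕ → ℝ
  | 0 => 1
  | m + 1 => tco q n m * ((1 + q ^ (n + 2 * m)) * (1 + q ^ (n + 2 * m + 1)) /
      ((1 - q ^ (2 * n + 1 + 2 * m)) * (1 - q ^ (2 * m + 2))))

noncomputable def gco (q : ℝ) : ℕ → ℝ
  | 0 => 1
  | k + 1 => gco q k * ((1 + q ^ k) / (1 - q ^ (k + 1)))

variable {q : ℝ}

theorem one_sub_pow_pos (h0 : 0 < q) (h1 : q < 1) (n : ℕ) : 0 < 1 - q ^ (n + 1) :=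
  sub_pos.2 (pow_lt_one₀ h0.le h1 (by omega))

theorem tco_pos (h0 : 0 < q) (h1 : q < 1) (n m : ℕ) : 0 < tco q n m := by
  induction m with
  | zero => simp [tco]
  | succ m ih =>
    have a1 := one_sub_pow_pos h0 h1 (2 * n + 2 * m)
    have a2 := one_sub_pow_pos h0 h1 (2 * m + 1)
    rw [show 2 * n + 2 * m + 1 = 2 * n + 1 + 2 * m by ring] at a1
    rw [tco]
    positivity

theorem gco_pos (h0 : 0 < q) (h1 : q < 1) (m : ℕ) : 0 < gco q m := by
  induction m with
  | zero => simp [gco]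
  | succ m ih =>
    have a2 := one_sub_pow_pos h0 h1 m
    rw [gco]
    positivity

theorem tco_shift (h0 : 0 < q) (h1 : q < 1) (n m : ℕ) :
    tco q (n + 1) m = tco q n m * ((1 + q ^ (n + 2 * m)) * (1 - q ^ (2 * n + 1)) /
      ((1 + q ^ n) * (1 - q ^ (2 * n + 2 * m + 1)))) := by
  induction m with
  | zero =>
    have a1 := (one_sub_pow_pos h0 h1 (2 * n)).ne'
    have a2 : 1 + q ^ n ≠ 0 := by positivity
    simp only [tco, mul_zero, add_zero]
    field_simp
  | succ m ih =>
    have a1 := (one_sub_pow_pos h0 h1 (2 * n)).ne'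
    have a2 : 1 + q ^ n ≠ 0 := by positivity
    have a3 := (one_sub_pow_pos h0 h1 (2 * n + 2 * m)).ne'
    have a4 := (one_sub_pow_pos h0 h1 (2 * n + 2 * m + 2)).ne'
    have a5 := (one_sub_pow_pos h0 h1 (2 * m + 1)).ne'
    have a6 : 1 + q ^ (n + 2 * m) ≠ 0 := by positivity
    rw [tco, ih, tco]
    rw [show 2 * (n + 1) + 1 + 2 * m = 2 * n + 2 * m + 2 + 1 by ring,
      show 2 * n + 1 + 2 * m = 2 * n + 2 * m + 1 by ring,
      show 2 * n + 2 * (m + 1) + 1 = 2 * n + 2 * m + 2 + 1 by ring,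
      show n + 1 + 2 * m = n + 2 * m + 1 by ring, show n + 2 * (m + 1) = n + 2 * m + 1 + 1 by ring]
    field_simp

theorem tco_rec (h0 : 0 < q) (h1 : q < 1) (n m : ℕ) :
    tco q n (m + 1) = tco q (n + 1) (m + 1) +
      q ^ n * (1 + q ^ (n + 1)) ^ 2 / ((1 - q ^ (2 * n + 1)) * (1 - q ^ (2 * n + 3))) *
        tco q (n + 2) m := by
  rw [tco_shift h0 h1 (n+1) m, tco_shift h0 h1 n (m+1), tco_shift h0 h1 n m, tco]
  have a1 := (one_sub_pow_pos h0 h1 (2 * n)).ne'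
  have a1' := (one_sub_pow_pos h0 h1 (2 * n + 2)).ne'
  have a2 : 1 + q ^ n ≠ 0 := by positivity
  have a2' : 1 + q ^ (n + 1) ≠ 0 := by positivity
  have a3 := (one_sub_pow_pos h0 h1 (2 * n + 2 * m)).ne'
  have a4 := (one_sub_pow_pos h0 h1 (2 * n + 2 * m + 2)).ne'
  have a5 := (one_sub_pow_pos h0 h1 (2 * m + 1)).ne'
  rw [show 2 * (n + 1) + 1 = 2 * n + 2 + 1 by ring, show 2 * (n + 1) + 2 * m + 1 = 2 * n + 2 * m + 2 + 1 by ring,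
      show 2 * n + 1 + 2 * m = 2 * n + 2 * m + 1 by ring,
      show 2 * n + 2 * (m + 1) + 1 = 2 * n + 2 * m + 2 + 1 by ring,
      show n + 1 + 2 * m = n + 2 * m + 1 by ring, show n + 2 * (m + 1) = n + 2 * m + 1 + 1 by ring]
  field_simp
  ring

theorem pow_lin_tendsto (h0 : 0 < q) (h1 : q < 1) (f : ℕ → ℕ) (hf : ∀ m, m ≤ f m) :
    Tendsto (fun m => q ^ (f m)) atTop (nhds 0) :=
  (tendsto_pow_atTop_nhds_zero_of_lt_one h0.le h1).comp
    (tendsto_atTop_mono hf tendsto_id)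

theorem tco_summable (h0 : 0 < q) (h1 : q < 1) {a : ℝ} (ha0 : 0 < a) (ha1 : a < 1) (n : ℕ) :
    Summable (fun m => tco q n m * a ^ (2 * m)) := by
  apply summable_of_ratio_test_tendsto_lt_one (l := a ^ 2) (by nlinarith)
  · exact Eventually.of_forall fun m => (mul_pos (tco_pos h0 h1 n m) (by positivity)).ne'
  · have : Tendsto (fun m => ((1 + q ^ (n + 2 * m)) * (1 + q ^ (n + 2 * m + 1)) /
      ((1 - q ^ (2 * n + 1 + 2 * m)) * (1 - q ^ (2 * m + 2)))) * a ^ 2) atTop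
      (nhds (((1 + 0) * (1 + 0) / ((1 - 0) * (1 - 0))) * a ^ 2)) := by
      refine Tendsto.mul_const _ (Tendsto.div ?_ ?_ (by norm_num))
      · exact ((pow_lin_tendsto h0 h1 _ (fun m => by omega)).const_add 1).mul
          ((pow_lin_tendsto h0 h1 _ (fun m => by omega)).const_add 1)
      · exact ((pow_lin_tendsto h0 h1 _ (fun m => by omega)).const_sub 1).mul
          ((pow_lin_tendsto h0 h1 _ (fun m => by omega)).const_sub 1)
    rw [show ((1 + 0) * (1 + 0) / ((1 - 0) * (1 - 0))) * a ^ 2 = a ^ 2 by ring] at this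
    refine this.congr fun m => ?_
    have p1 := tco_pos h0 h1 n m
    have p2 := tco_pos h0 h1 n (m+1)
    rw [Real.norm_of_nonneg (by positivity), Real.norm_of_nonneg (by positivity), tco]
    have : a ^ (2 * (m + 1)) = a ^ (2 * m) * a ^ 2 := by ring
    rw [this]
    field_simp

theorem gco_summable (h0 : 0 < q) (h1 : q < 1) {a : ℝ} (ha1 : |a| < 1) :
    Summable (fun m => gco q m * a ^ m) := by
  by_cases ha : a = 0
  · subst ha
    refine summable_of_ne_finset_zero (s := {0}) fun b hb => ?_
    simp at hb
    simp [hb]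
  apply summable_of_ratio_test_tendsto_lt_one (l := |a|) ha1
  · exact Eventually.of_forall fun m => mul_ne_zero (gco_pos h0 h1 m).ne' (pow_ne_zero _ ha)
  · have : Tendsto (fun m => ((1 + q ^ m) / (1 - q ^ (m + 1))) * |a|) atTop
      (nhds (((1 + 0) / (1 - 0)) * |a|)) := by
      refine Tendsto.mul_const _ (Tendsto.div ?_ ?_ (by norm_num))
      · exact ((pow_lin_tendsto h0 h1 _ (fun m => by omega)).const_add 1)
      · exact ((pow_lin_tendsto h0 h1 _ (fun m => by omega)).const_sub 1)
    rw [show (((1:ℝ) + 0) / (1 - 0)) * |a| = |a| by ring] at this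
    refine this.congr fun m => ?_
    have p1 := gco_pos h0 h1 m
    have p2 := gco_pos h0 h1 (m+1)
    rw [norm_mul, norm_mul, Real.norm_of_nonneg p1.le, Real.norm_of_nonneg p2.le, gco, norm_pow,
      norm_pow, Real.norm_eq_abs, pow_succ]
    have := abs_pos.2 ha
    field_simp
    ring

noncomputable def Gf (q a : ℝ) : ℝ := ∑' m, gco q m * a ^ m

theorem Gf_func (h0 : 0 < q) (h1 : q < 1) {a : ℝ} (ha1 : |a| < 1) :
    (1 - a) * Gf q a = (1 + a) * Gf q (q * a) := by
  have hqa : |q * a| < 1 := by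
    rw [abs_mul, abs_of_pos h0]
    nlinarith [abs_nonneg a]
  have s1 := gco_summable h0 h1 ha1
  have s2 := gco_summable h0 h1 hqa
  have e1 : Gf q a - Gf q (q * a) = ∑' m, (gco q (m+1) * a ^ (m+1) - gco q (m+1) * (q * a) ^ (m+1)) := by
    unfold Gf
    rw [s1.tsum_eq_zero_add, s2.tsum_eq_zero_add,
      Summable.tsum_sub ((summable_nat_add_iff 1).2 s1) ((summable_nat_add_iff 1).2 s2)]
    simp
  have e2 : a * Gf q a + a * Gf q (q * a) = ∑' m, (a * (gco q m * a ^ m) + a * (gco q m * (q * a) ^ m)) := by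
    unfold Gf
    rw [Summable.tsum_add (s1.mul_left a) (s2.mul_left a), tsum_mul_left, tsum_mul_left]
  have : Gf q a - Gf q (q * a) = a * Gf q a + a * Gf q (q * a) := by
    rw [e1, e2]
    congr 1
    ext m
    have := (one_sub_pow_pos h0 h1 m).ne'
    rw [gco, mul_pow, mul_pow]
    field_simp
    ring
  linarith

theorem Gf_zero : Gf q 0 = 1 := by
  unfold Gf
  rw [tsum_eq_single 0]
  · simp [gco]
  · intro b hb
    simp [hb]

theorem Gf_tendsto (h0 : 0 < q) (h1 : q < 1) {a : ℝ} (ha1 : |a| < 1) :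
    Tendsto (fun N : ℕ => Gf q (q ^ N * a)) atTop (nhds 1) := by
  rw [← Gf_zero (q := q)]
  have s1 := gco_summable h0 h1 (a := |a|) (by rwa [abs_abs])
  refine tendsto_tsum_of_dominated_convergence s1 ?_ ?_
  · intro k
    refine Tendsto.const_mul _ (Tendsto.pow ?_ k)
    have := (tendsto_pow_atTop_nhds_zero_of_lt_one h0.le h1).mul_const a
    simpa using this
  · refine Eventually.of_forall fun N k => ?_
    have p1 := gco_pos h0 h1 k
    rw [norm_mul, Real.norm_of_nonneg p1.le, norm_pow, Real.norm_eq_abs, abs_mul, abs_pow, abs_of_pos h0]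
    have : q ^ N ≤ 1 := pow_le_one₀ h0.le h1.le
    gcongr
    nlinarith [abs_nonneg a]

theorem abs_pow_mul_lt (h0 : 0 < q) (h1 : q < 1) {a : ℝ} (ha1 : |a| < 1) (N : ℕ) : |q ^ N * a| < 1 := by
  rw [abs_mul, abs_pow, abs_of_pos h0]
  have : q ^ N ≤ 1 := pow_le_one₀ h0.le h1.le
  nlinarith [abs_nonneg a]

theorem Gf_inv (h0 : 0 < q) (h1 : q < 1) {a : ℝ} (ha1 : |a| < 1) :
    Gf q a * Gf q (-a) = 1 := by
  have key : ∀ N : ℕ, Gf q (q ^ N * a) * Gf q (q ^ N * (-a)) = Gf q a * Gf q (-a) := by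
    intro N
    induction N with
    | zero => simp
    | succ N ih =>
      rw [← ih]
      have hx := abs_pow_mul_lt h0 h1 ha1 N
      set x := q ^ N * a with hxd
      have f1 := Gf_func h0 h1 hx
      have f2 := Gf_func h0 h1 (a := -x) (by rwa [abs_neg])
      rw [show q ^ (N+1) * a = q * x by rw [hxd]; ring,
        show q ^ (N+1) * (-a) = q * (-x) by rw [hxd]; ring,
        show q ^ N * (-a) = -x by rw [hxd]; ring]
      obtain ⟨l1, l2⟩ := abs_lt.1 hx
      have n1 : (1 - x) ≠ 0 := by linarith
      have n2 : (1 + x) ≠ 0 := by linarith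
      have : (1 - x) * (1 + x) * (Gf q (q * x) * Gf q (q * -x)) =
        (1 - x) * (1 + x) * (Gf q x * Gf q (-x)) := by
        linear_combination (-(1 - x) * Gf q (q * -x)) * f1 - (1 - x) * Gf q x * f2
      exact mul_left_cancel₀ (mul_ne_zero n1 n2) this
  have l1 := (Gf_tendsto h0 h1 ha1).mul (Gf_tendsto h0 h1 (a := -a) (by rwa [abs_neg]))
  simp only [key, mul_one] at l1
  exact tendsto_nhds_unique tendsto_const_nhds l1

theorem tco_zero_eq (h0 : 0 < q) (h1 : q < 1) (m : ℕ) : tco q 0 m = gco q (2 * m) := by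
  induction m with
  | zero => simp [tco, gco]
  | succ m ih =>
    rw [tco, ih, show 2 * (m + 1) = 2 * m + 1 + 1 by ring, gco, gco]
    have a1 := (one_sub_pow_pos h0 h1 (2 * m)).ne'
    have a2 := (one_sub_pow_pos h0 h1 (2 * m + 1)).ne'
    rw [show 0 + 2 * m = 2 * m by ring, show 2 * 0 + 1 + 2 * m = 2 * m + 1 by ring]
    field_simp

theorem tco_one_eq (h0 : 0 < q) (h1 : q < 1) (m : ℕ) :
    2 / (1 - q) * tco q 1 m = gco q (2 * m + 1) := by
  induction m with
  | zero => simp [tco, gco]; norm_num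
  | succ m ih =>
    rw [tco, ← mul_assoc, ih, show 2 * (m + 1) + 1 = 2 * m + 1 + 1 + 1 by ring, gco.eq_2 q (2*m+1+1), gco.eq_2 q (2*m+1)]
    have a1 := (one_sub_pow_pos h0 h1 (2 * m + 1)).ne'
    have a2 := (one_sub_pow_pos h0 h1 (2 * m + 1 + 1)).ne'
    rw [show 1 + 2 * m = 2 * m + 1 by ring, show 2 * 1 + 1 + 2 * m = 2 * m + 1 + 1 + 1 by ring]
    field_simp

theorem cf_main (h0 : 0 < q) (h1 : q < 1) {a : ℝ} (ha0 : 0 < a) (ha1 : a < 1) :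
    ∃ L : ℝ,
      CFTendsto
        (fun n => if n = 1 then 2 * a
          else a ^ 2 * q ^ (n - 2) * (1 + q ^ (n - 1)) ^ 2)
        (fun n => 1 - q ^ (2 * n - 1)) L ∧
      L ≠ 1 ∧
      -1 + 2 / (1 - L) = Gf q a ^ 2 := by
  have haa : |a| < 1 := by rwa [abs_of_pos ha0]
  set φ : ℕ → ℝ := fun n => ∑' m, tco q n m * a ^ (2 * m) with hφd
  have hs := fun n => tco_summable h0 h1 ha0 ha1 n
  have hφ : ∀ n, 0 < φ n := fun n =>
    (hs n).tsum_pos (fun m => (mul_pos (tco_pos h0 h1 n m) (by positivity)).le) 0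
      (mul_pos (tco_pos h0 h1 n 0) (by positivity))
  have hcf := cf_tendsto (fun n => if n = 1 then 2 * a
          else a ^ 2 * q ^ (n - 2) * (1 + q ^ (n - 1)) ^ 2)
        (fun n => 1 - q ^ (2 * n - 1)) φ
        (fun n => by split_ifs <;> positivity)
        (fun n => one_sub_pow_pos h0 h1 (2 * n)) hφ
        (fun n => by
          simp only [Nat.add_sub_cancel,
            show n + 2 ≠ 1 by omega, if_false]
          rw [show n + 2 - 1 = n + 1 by omega, show 2 * (n + 1) - 1 = 2 * n + 1 by omega,
            show 2 * (n + 2) - 1 = 2 * n + 3 by omega]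
          simp only [hφd]
          rw [(hs n).tsum_eq_zero_add, (hs (n+1)).tsum_eq_zero_add, add_assoc, ← tsum_mul_left,
            ← Summable.tsum_add ((summable_nat_add_iff 1).2 (hs (n+1))) ((hs (n+2)).mul_left _)]
          congr 2
          ext m
          rw [tco_rec h0 h1 n m]
          ring)
        (by
          have : Tendsto (fun n : ℕ => (a ^ 2 * q ^ n * (1 + q ^ (n + 1)) ^ 2) / ((1 - q ^ (2 * n + 1)) * (1 - q ^ (2 * n + 3)))) atTop
            (nhds ((a ^ 2 * 0 * (1 + 0) ^ 2) / ((1 - 0) * (1 - 0)))) := by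
            refine Tendsto.div ?_ ?_ (by norm_num)
            · exact ((pow_lin_tendsto h0 h1 _ (fun m => by omega)).const_mul _).mul
               (((pow_lin_tendsto h0 h1 _ (fun m => by omega)).const_add 1).pow 2)
            · exact ((pow_lin_tendsto h0 h1 _ (fun m => by omega)).const_sub 1).mul
               ((pow_lin_tendsto h0 h1 _ (fun m => by omega)).const_sub 1)
          rw [show (a ^ 2 * 0 * (1 + 0) ^ 2) / ((1 - 0) * (1 - 0)) = (0:ℝ) by ring] at this
          refine this.congr fun n => ?_
          simp only [show n + 2 ≠ 1 by omega, if_false]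
          rw [show n + 2 - 1 = n + 1 by omega, show 2 * (n + 1) - 1 = 2 * n + 1 by omega,
            show 2 * (n + 2) - 1 = 2 * n + 3 by omega, show n + 2 - 2 = n by omega])
  have hcf' : CFTendsto (fun n => if n = 1 then 2 * a
          else a ^ 2 * q ^ (n - 2) * (1 + q ^ (n - 1)) ^ 2)
        (fun n => 1 - q ^ (2 * n - 1)) (2 * a / (1 - q) * φ 1 / φ 0) := by
    have e1 : (if (1:ℕ) = 1 then 2 * a else a ^ 2 * q ^ (1 - 2) * (1 + q ^ (1 - 1)) ^ 2) = 2 * a :=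
      if_pos rfl
    have e2 : 1 - q ^ (2 * 1 - 1) = 1 - q := by norm_num
    rw [e1, e2] at hcf
    exact hcf
  clear hcf
  have sE : Summable (fun m => gco q (2 * m) * a ^ (2 * m)) := by
    simpa only [tco_zero_eq h0 h1] using hs 0
  have hE : φ 0 = ∑' m, gco q (2 * m) * a ^ (2 * m) := by
    simp only [hφd, tco_zero_eq h0 h1]
  have hOt : ∀ m, gco q (2 * m + 1) * a ^ (2 * m + 1) = (2 * a / (1 - q)) * (tco q 1 m * a ^ (2 * m)) := by
    intro m
    rw [← tco_one_eq h0 h1]; ring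
  have sO : Summable (fun m => gco q (2 * m + 1) * a ^ (2 * m + 1)) := by
    simp only [hOt]
    exact (hs 1).mul_left _
  have hO : 2 * a / (1 - q) * φ 1 = ∑' m, gco q (2 * m + 1) * a ^ (2 * m + 1) := by
    simp only [hOt, hφd, tsum_mul_left]
  have hp : Gf q a = φ 0 + 2 * a / (1 - q) * φ 1 := by
    rw [hE, hO]
    exact (tsum_even_add_odd (f := fun m => gco q m * a ^ m) sE sO).symm
  have hm : Gf q (-a) = φ 0 - 2 * a / (1 - q) * φ 1 := by
    rw [hE, hO, sub_eq_add_neg, ← tsum_neg]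
    have e1 : ∀ m, gco q (2 * m) * a ^ (2 * m) = gco q (2 * m) * (-a) ^ (2 * m) := by
      intro m; rw [pow_mul, pow_mul, neg_sq]
    have e2 : ∀ m, -(gco q (2 * m + 1) * a ^ (2 * m + 1)) = gco q (2 * m + 1) * (-a) ^ (2 * m + 1) := by
      intro m; rw [pow_succ, pow_succ, pow_mul, pow_mul, neg_sq]; ring
    simp only [e1, e2]
    simp only [e1] at sE
    have sO' := sO.neg
    simp only [e2] at sO'
    exact (tsum_even_add_odd (f := fun m => gco q m * (-a) ^ m) sE sO').symm
  have hinv := Gf_inv h0 h1 haa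
  refine ⟨_, hcf', ?_, ?_⟩
  · intro h
    rw [div_eq_one_iff_eq (hφ 0).ne'] at h
    rw [hm, h] at hinv
    simp at hinv
  · have hE0 := (hφ 0).ne'
    have hm0 : Gf q (-a) ≠ 0 := right_ne_zero_of_mul (by rw [hinv]; exact one_ne_zero)
    have : 1 - 2 * a / (1 - q) * φ 1 / φ 0 = Gf q (-a) / φ 0 := by
      rw [hm]; field_simp
    rw [this]
    have h2 : φ 0 = (Gf q a + Gf q (-a)) / 2 := by rw [hp, hm]; ring
    have h3 : 2 / (Gf q (-a) / φ 0) = (Gf q a + Gf q (-a)) / Gf q (-a) := by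
      rw [h2]; 
      have : Gf q a + Gf q (-a) ≠ 0 := by
        intro h; rw [h] at h2; simp at h2; exact hE0 h2
      field_simp
    rw [h3, add_div, div_self hm0, pow_two]
    have : Gf q a = 1 / Gf q (-a) := by field_simp; exact hinv
    rw [add_comm, add_assoc]
    nth_rewrite 3 [this]
    ring

end PartA

section PartB
variable {q : ℝ}

noncomputable def Pp (q : ℝ) : ℕ → ℝ
  | 0 => 1
  | n + 1 => Pp q n * ((1 - q ^ (n + 1)) / (1 + q ^ (n + 1)))

theorem Pp_pos (h0 : 0 < q) (h1 : q < 1) (n : ℕ) : 0 < Pp q n := by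
  induction n with
  | zero => simp [Pp]
  | succ n ih =>
    have := one_sub_pow_pos h0 h1 n
    rw [Pp]; positivity

theorem Pp_anti (h0 : 0 < q) (h1 : q < 1) : Antitone (Pp q) := by
  refine antitone_nat_of_succ_le fun n => ?_
  have := one_sub_pow_pos h0 h1 n
  have h := Pp_pos h0 h1 n
  rw [Pp]
  have : (1 - q ^ (n + 1)) / (1 + q ^ (n + 1)) ≤ 1 := by
    rw [div_le_one (by positivity)]
    have : 0 < q ^ (n+1) := by positivity
    linarith
  nlinarith

noncomputable def shk (q : ℝ) (n s : ℕ) : ℝ :=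
  (-1) ^ s * (Pp q n / Pp q s) * q ^ (s * (n + 1)) * (2 / (1 + q ^ s))

theorem shk_tele (h0 : 0 < q) (h1 : q < 1) (n m : ℕ) :
    ∑ s ∈ Finset.range (m + 1), (shk q (n + 1) s - shk q n s) =
      2 * Pp q n / (1 + q ^ (n + 1)) * ((-1) ^ (m + 1) * q ^ ((m + 1) * (n + 1)) / Pp q m) := by
  induction m with
  | zero =>
    have := (Pp_pos h0 h1 n).ne'
    simp [shk, Pp]
    have : 1 + q ^ (n+1) ≠ 0 := by positivity
    field_simp
    ring
  | succ m ih =>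
    rw [Finset.sum_range_succ, ih]
    have p1 := (Pp_pos h0 h1 n).ne'
    have p2 := (Pp_pos h0 h1 m).ne'
    have p3 := (one_sub_pow_pos h0 h1 m).ne'
    have p4 : 1 + q ^ (n+1) ≠ 0 := by positivity
    have p5 : 1 + q ^ (m+1) ≠ 0 := by positivity
    simp only [shk, Pp]
    rw [show q ^ ((m + 1) * (n + 1 + 1)) = q ^ ((m + 1) * (n + 1)) * q ^ (m + 1) by ring,
      show q ^ ((m + 1 + 1) * (n + 1)) = q ^ ((m + 1) * (n + 1)) * q ^ (n + 1) by ring,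
      pow_succ (-1) (m+1)]
    generalize q ^ ((m + 1) * (n + 1)) = X at *
    generalize q ^ (n + 1) = Y at *
    generalize q ^ (m + 1) = Z at *
    generalize (-1 : ℝ) ^ (m + 1) = W at *
    field_simp
    ring

theorem shanks (h0 : 0 < q) (h1 : q < 1) (n : ℕ) :
    ∑ s ∈ Finset.range (n + 1), shk q n s =
      1 + 2 * ∑ s ∈ Finset.range n, (-1) ^ (s + 1) * q ^ ((s + 1) ^ 2) := by
  induction n with
  | zero => simp [shk, Pp]; norm_num
  | succ n ih =>
    have := shk_tele h0 h1 n n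
    rw [Finset.sum_sub_distrib, ih] at this
    rw [Finset.sum_range_succ, sub_eq_iff_eq_add.1 this, Finset.sum_range_succ _ n]
    have p1 := (Pp_pos h0 h1 n).ne'
    have p2 := (Pp_pos h0 h1 (n+1)).ne'
    have p4 : 1 + q ^ (n+1) ≠ 0 := by positivity
    simp only [shk]
    rw [show q ^ ((n + 1) * (n + 1 + 1)) = q ^ ((n + 1) * (n + 1)) * q ^ (n + 1) by ring,
      show (n + 1) ^ 2 = (n + 1) * (n + 1) by ring]
    generalize q ^ ((n + 1) * (n + 1)) = X at *
    field_simp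
    ring

theorem shanks_lim (h0 : 0 < q) (h1 : q < 1) :
    Tendsto (fun n => (1 + 2 * ∑ s ∈ Finset.range n, (-1) ^ (s + 1) * q ^ ((s + 1) ^ 2)) - Pp q n)
      atTop (nhds 0) := by
  rw [tendsto_zero_iff_norm_tendsto_zero]
  have hl : Tendsto (fun n : ℕ => 2 * q ^ n * (1 - q)⁻¹) atTop (nhds 0) := by
    have := ((tendsto_pow_atTop_nhds_zero_of_lt_one h0.le h1).const_mul 2).mul_const (1 - q)⁻¹
    simpa using this
  refine squeeze_zero (fun n => norm_nonneg _) (fun n => ?_) hl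
  rw [← shanks h0 h1, Finset.sum_range_succ']
  have : shk q n 0 = Pp q n := by simp [shk, Pp]; norm_num
  rw [this, add_sub_cancel_right]
  calc _ ≤ ∑ k ∈ Finset.range n, ‖shk q n (k + 1)‖ := norm_sum_le _ _
    _ ≤ ∑ k ∈ Finset.range n, 2 * q ^ n * q ^ k := by
      refine Finset.sum_le_sum fun k hk => ?_
      have hk' : k + 1 ≤ n := Finset.mem_range.1 hk
      have p1 := Pp_pos h0 h1 n
      have p2 := Pp_pos h0 h1 (k+1)
      have hle : Pp q n / Pp q (k+1) ≤ 1 := (div_le_one p2).2 (Pp_anti h0 h1 hk')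
      rw [shk, norm_mul, norm_mul, norm_mul, norm_pow, norm_neg, norm_one, one_pow, one_mul,
        Real.norm_of_nonneg (by positivity), Real.norm_of_nonneg (by positivity),
        Real.norm_of_nonneg (by positivity)]
      have e1 : 2 / (1 + q ^ (k+1)) ≤ 2 := div_le_self (by norm_num) (by
        have : 0 < q ^ (k+1) := by positivity
        linarith)
      have e2 : q ^ ((k + 1) * (n + 1)) ≤ q ^ (n + k) :=
        pow_le_pow_of_le_one h0.le h1.le (by nlinarith)
      calc _ ≤ 1 * q ^ (n + k) * 2 := by gcongr
        _ = _ := by ring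
    _ = 2 * q ^ n * ∑ k ∈ Finset.range n, q ^ k := by rw [Finset.mul_sum]
    _ ≤ _ := by
      gcongr
      rw [← tsum_geometric_of_lt_one h0.le h1]
      exact Summable.sum_le_tsum _ (fun i _ => by positivity) (summable_geometric_of_lt_one h0.le h1)

end PartB

section PartC
open Real intervalIntegral

noncomputable def Jf (a b t : ℝ) : ℝ := 1 / √(a ^ 2 * cos t ^ 2 + b ^ 2 * sin t ^ 2)
noncomputable def Jint (a b : ℝ) : ℝ := ∫ t in (0 : ℝ)..(π / 2), Jf a b t

theorem Jrad_pos {a b : ℝ} (ha : 0 < a) (hb : 0 < b) (t : ℝ) :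
    0 < a ^ 2 * cos t ^ 2 + b ^ 2 * sin t ^ 2 := by
  have h := sin_sq_add_cos_sq t
  by_cases hc : cos t = 0
  · rw [hc] at h ⊢
    have : sin t ^ 2 = 1 := by linarith
    rw [this]; positivity
  · positivity

theorem Jf_cont {a b : ℝ} (ha : 0 < a) (hb : 0 < b) : Continuous (Jf a b) := by
  unfold Jf
  refine Continuous.div continuous_const (by fun_prop) fun t => ?_
  exact (sqrt_pos.2 (Jrad_pos ha hb t)).ne'

theorem Jint_agm {a b : ℝ} (ha : 0 < a) (hb : 0 < b) :
    Jint a b = Jint ((a + b) / 2) (√(a * b)) := by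
  have hab : 0 < a * b := mul_pos ha hb
  have hm : 0 < (a + b) / 2 := by positivity
  have hs : 0 < √(a * b) := sqrt_pos.2 hab
  set w : ℝ → ℝ := fun s => a * cos s ^ 2 + b * sin s ^ 2 with hw
  have hwpos : ∀ s, 0 < w s := by
    intro s
    have := Jrad_pos (sqrt_pos.2 ha) (sqrt_pos.2 hb) s
    rwa [sq_sqrt ha.le, sq_sqrt hb.le] at this
  set g : ℝ → ℝ := fun s => (a - b) * (sin s * cos s) / w s with hg
  set T : ℝ → ℝ := fun s => 2 * s - arctan (g s) with hT
  set D : ℝ → ℝ := fun s => a ^ 2 * cos s ^ 2 + b ^ 2 * sin s ^ 2 with hD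
  have hDpos : ∀ s, 0 < D s := fun s => Jrad_pos ha hb s
  have h1g : ∀ s, 1 + g s ^ 2 = D s / w s ^ 2 := by
    intro s
    have := (hwpos s).ne'
    simp only [hg]
    field_simp
    simp only [hw, hD]
    have h := sin_sq s
    rw [h]; ring
  have hTd : ∀ s, HasDerivAt T (1 + a * b / D s) s := by
    intro s
    have hwd : HasDerivAt w (a * (2 * cos s * (-sin s)) + b * (2 * sin s * cos s)) s := by
      have e1 := ((hasDerivAt_cos s).pow 2).const_mul a
      have e2 := ((hasDerivAt_sin s).pow 2).const_mul b
      refine (e1.add e2).congr_deriv ?_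
      norm_num
    have hgd : HasDerivAt g (((a - b) * (cos s * cos s + sin s * -sin s) * w s -
        (a - b) * (sin s * cos s) * (a * (2 * cos s * (-sin s)) + b * (2 * sin s * cos s))) /
          w s ^ 2) s :=
      (((hasDerivAt_sin s).mul (hasDerivAt_cos s)).const_mul (a - b)).div hwd (hwpos s).ne'
    have hd : HasDerivAt T (2 * 1 - 1 / (1 + g s ^ 2) * (((a - b) * (cos s * cos s + sin s * -sin s) * w s -
        (a - b) * (sin s * cos s) * (a * (2 * cos s * (-sin s)) + b * (2 * sin s * cos s))) /
          w s ^ 2)) s :=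
      ((hasDerivAt_id s).const_mul 2).sub hgd.arctan
    refine hd.congr_deriv ?_
    rw [h1g s]
    have n1 := (hwpos s).ne'
    have n2 := (hDpos s).ne'
    have key : (a - b) * (cos s * cos s + sin s * -sin s) * w s -
        (a - b) * (sin s * cos s) * (a * (2 * cos s * (-sin s)) + b * (2 * sin s * cos s)) =
        D s - a * b := by
      simp only [hw, hD]
      have h := sin_sq s
      linear_combination (a - b) * (a * cos s ^ 2 - b * sin s ^ 2) * h - a * b * h
    rw [key]
    field_simp
    ring
  have hsq : ∀ s, √(1 + g s ^ 2) = √(D s) / w s := by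
    intro s
    rw [h1g, sqrt_div (hDpos s).le, sqrt_sq (hwpos s).le]
  have hcosT : ∀ s, cos (T s) = (a * cos s ^ 2 - b * sin s ^ 2) / √(D s) := by
    intro s
    have n1 := (hwpos s).ne'
    have n2 := (sqrt_pos.2 (hDpos s)).ne'
    simp only [hT]
    rw [cos_sub, cos_arctan, sin_arctan, hsq, sin_two_mul, cos_two_mul']
    simp only [hg]
    field_simp
    simp only [hw]
    have h := sin_sq s
    linear_combination (a * cos s ^ 2 - b * sin s ^ 2) * h
  have hsinT : ∀ s, sin (T s) = (a + b) * (sin s * cos s) / √(D s) := by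
    intro s
    have n1 := (hwpos s).ne'
    have n2 := (sqrt_pos.2 (hDpos s)).ne'
    simp only [hT]
    rw [sin_sub, cos_arctan, sin_arctan, hsq, sin_two_mul, cos_two_mul']
    simp only [hg]
    field_simp
    simp only [hw]
    have h := sin_sq s
    linear_combination sin s * cos s * (a + b) * h
  have hint : ∀ s, Jf ((a + b) / 2) (√(a * b)) (T s) * (1 + a * b / D s) = 2 * Jf a b s := by
    intro s
    have hDp := hDpos s
    have hsD := sqrt_pos.2 hDp
    have hwp := hwpos s
    have e : ((a + b) / 2) ^ 2 * cos (T s) ^ 2 + √(a * b) ^ 2 * sin (T s) ^ 2 =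
      ((a + b) / 2 * w s / √(D s)) ^ 2 := by
      rw [hcosT, hsinT, sq_sqrt hab.le]
      field_simp
      simp only [hw]
      ring
    unfold Jf
    rw [e, sqrt_sq (by positivity)]
    change _ = 2 * (1 / √(D s))
    have e2 : D s + a * b = (a + b) * w s := by
      simp only [hD, hw]
      have h := sin_sq s
      rw [h]; ring
    have e3 : 1 + a * b / D s = (a + b) * w s / (√(D s) * √(D s)) := by
      rw [mul_self_sqrt hDp.le, ← e2]
      field_simp
    rw [e3]
    field_simp
  have hsub := integral_comp_mul_deriv (a := 0) (b := π / 2) (f := T) (f' := fun s => 1 + a * b / D s)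
    (g := Jf ((a + b) / 2) (√(a * b))) (fun x _ => hTd x)
    (by
      refine Continuous.continuousOn ?_
      refine continuous_const.add (Continuous.div continuous_const (by fun_prop) fun s => (hDpos s).ne'))
    (Jf_cont hm hs)
  have hT0 : T 0 = 0 := by simp [hT, hg]
  have hT1 : T (π / 2) = π := by simp [hT, hg]; ring
  rw [hT0, hT1] at hsub
  simp only [Function.comp, hint] at hsub
  rw [integral_const_mul] at hsub
  have hsym : ∫ t in (0:ℝ)..π, Jf ((a + b) / 2) (√(a * b)) t = 2 * Jint ((a + b) / 2) (√(a * b)) := by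
    have hi := fun x y => (Jf_cont hm hs).intervalIntegrable (μ := MeasureTheory.volume) x y
    rw [← integral_add_adjacent_intervals (hi 0 (π/2)) (hi (π/2) π)]
    have : ∫ t in (π/2)..π, Jf ((a + b) / 2) (√(a * b)) t = ∫ t in (0:ℝ)..(π/2), Jf ((a + b) / 2) (√(a * b)) t := by
      have := integral_comp_sub_left (a := 0) (b := π / 2) (fun t => Jf ((a + b) / 2) (√(a * b)) t) π
      rw [sub_zero, show π - π / 2 = π / 2 by ring] at this
      rw [← this]
      refine integral_congr fun t _ => ?_
      simp [Jf]
    rw [this]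
    unfold Jint
    ring
  rw [hsym] at hsub
  unfold Jint at hsub ⊢
  linarith

theorem Jint_bounds {a b m M : ℝ} (hm : 0 < m) (ha : m ≤ a) (hb : m ≤ b) (ha' : a ≤ M) (hb' : b ≤ M) :
    π / 2 / M ≤ Jint a b ∧ Jint a b ≤ π / 2 / m := by
  have ha0 := hm.trans_le ha
  have hb0 := hm.trans_le hb
  have hM := ha0.trans_le ha'
  have hpi := pi_pos
  have hi := (Jf_cont ha0 hb0).intervalIntegrable (μ := MeasureTheory.volume) 0 (π/2)
  constructor
  · have : ∫ t in (0:ℝ)..(π/2), 1 / M = π / 2 / M := by simp; ring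
    rw [← this]
    refine integral_mono_on (by positivity) (by simp) hi fun t _ => ?_
    refine one_div_le_one_div_of_le (sqrt_pos.2 (Jrad_pos ha0 hb0 t)) ?_
    refine sqrt_le_iff.2 ⟨hM.le, ?_⟩
    have h := sin_sq_add_cos_sq t
    calc _ ≤ M ^ 2 * cos t ^ 2 + M ^ 2 * sin t ^ 2 := by gcongr
      _ = M ^ 2 * (sin t ^ 2 + cos t ^ 2) := by ring
      _ = _ := by rw [h, mul_one]
  · have : ∫ t in (0:ℝ)..(π/2), 1 / m = π / 2 / m := by simp; ring
    rw [← this]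
    refine integral_mono_on (by positivity) hi (by simp) fun t _ => ?_
    refine one_div_le_one_div_of_le hm ?_
    refine le_sqrt_of_sq_le ?_
    have h := sin_sq_add_cos_sq t
    calc _ = m ^ 2 * (sin t ^ 2 + cos t ^ 2) := by rw [h, mul_one]
      _ = m ^ 2 * cos t ^ 2 + m ^ 2 * sin t ^ 2 := by ring
      _ ≤ _ := by gcongr

theorem Jint_lim {a b : ℕ → ℝ} (ha : ∀ n, 0 < a n) (hb : ∀ n, 0 < b n)
    (h1 : ∀ n, a (n + 1) = (a n + b n) / 2) (h2 : ∀ n, b (n + 1) = √(a n * b n))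
    (la : Tendsto a atTop (nhds 1)) (lb : Tendsto b atTop (nhds 1)) :
    Jint (a 0) (b 0) = π / 2 := by
  have hc : ∀ n, Jint (a n) (b n) = Jint (a 0) (b 0) := by
    intro n
    induction n with
    | zero => rfl
    | succ n ih => rw [← ih, h1, h2, Jint_agm (ha n) (hb n)]
  have l1 : Tendsto (fun n => π / 2 / max (a n) (b n)) atTop (nhds (π / 2 / max 1 1)) :=
    tendsto_const_nhds.div (la.max lb) (by simp)
  have l2 : Tendsto (fun n => π / 2 / min (a n) (b n)) atTop (nhds (π / 2 / min 1 1)) :=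
    tendsto_const_nhds.div (la.min lb) (by simp)
  simp only [max_self, min_self, div_one] at l1 l2
  have hbd := fun n => Jint_bounds (lt_min (ha n) (hb n)) (min_le_left _ _) (min_le_right _ _)
    (le_max_left (a n) (b n)) (le_max_right (a n) (b n))
  have := tendsto_of_tendsto_of_tendsto_of_le_of_le l1 l2 (fun n => (hbd n).1) (fun n => (hbd n).2)
  simp only [hc] at this
  exact tendsto_nhds_unique tendsto_const_nhds this

theorem Jint_scale {a b c : ℝ} (hc : 0 < c) : Jint (c * a) (c * b) = Jint a b / c := by
  unfold Jint
  rw [← integral_div]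
  refine integral_congr fun t _ => ?_
  simp only [Jf]
  rw [show (c * a) ^ 2 * cos t ^ 2 + (c * b) ^ 2 * sin t ^ 2 =
    c ^ 2 * (a ^ 2 * cos t ^ 2 + b ^ 2 * sin t ^ 2) by ring, sqrt_mul (by positivity), sqrt_sq hc.le,
    div_div, mul_comm]

theorem Kint_eq {k k' : ℝ} (h : k ^ 2 + k' ^ 2 = 1) : Kint k = Jint 1 k' := by
  unfold Kint Jint
  refine integral_congr fun t _ => ?_
  simp only [Jf]
  have := sin_sq_add_cos_sq t
  congr 2
  rw [show k' ^ 2 = 1 - k ^ 2 by linarith]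
  linear_combination -this

theorem Jint_strict {b b' : ℝ} (hb : 0 < b) (h : b < b') : Jint 1 b' < Jint 1 b := by
  have hb' := hb.trans h
  have hpi := pi_pos
  have hsq : b ^ 2 < b' ^ 2 := by gcongr
  refine integral_lt_integral_of_continuousOn_of_le_of_exists_lt (by positivity)
    (Jf_cont one_pos hb').continuousOn (Jf_cont one_pos hb).continuousOn ?_ ⟨π / 2, ?_, ?_⟩
  · intro t _
    refine one_div_le_one_div_of_le (sqrt_pos.2 (Jrad_pos one_pos hb t)) ?_
    gcongr
  · constructor <;> linarith
  · refine one_div_lt_one_div_of_lt (sqrt_pos.2 (Jrad_pos one_pos hb _)) ?_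
    apply sqrt_lt_sqrt (Jrad_pos one_pos hb _).le
    simpa using hsq
end PartC

section PartD
open Real

noncomputable def th3 (t : ℝ) : ℝ := ∑' n : ℤ, exp (-π * t * (n : ℝ) ^ 2)
noncomputable def th4 (t : ℝ) : ℝ := ∑' n : ℤ, (-1 : ℝ) ^ n * exp (-π * t * (n : ℝ) ^ 2)
noncomputable def th2 (t : ℝ) : ℝ := ∑' n : ℤ, exp (-π * t * ((n : ℝ) + 1 / 2) ^ 2)

theorem norm_neg_one_zpow (n : ℤ) : ‖(-1 : ℝ) ^ n‖ = 1 := by simp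

theorem s3 {t : ℝ} (ht : 0 < t) : Summable fun n : ℤ => exp (-π * t * (n : ℝ) ^ 2) := by
  have h := ((summable_jacobiTheta₂_term_iff 0 (t * Complex.I)).2 (by simpa using ht)).norm
  simp only [norm_jacobiTheta₂_term] at h
  refine h.congr fun n => ?_
  congr 1
  simp
  ring

theorem s2 {t : ℝ} (ht : 0 < t) : Summable fun n : ℤ => exp (-π * t * ((n : ℝ) + 1 / 2) ^ 2) := by
  have h := ((summable_jacobiTheta₂_term_iff (t / 2 * Complex.I) (t * Complex.I)).2 (by simpa using ht)).norm
  simp only [norm_jacobiTheta₂_term] at h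
  refine (h.mul_right (exp (-π * t / 4))).congr fun n => ?_
  rw [← exp_add]
  congr 1
  simp
  ring

theorem s4 {t : ℝ} (ht : 0 < t) : Summable fun n : ℤ => (-1 : ℝ) ^ n * exp (-π * t * (n : ℝ) ^ 2) := by
  refine Summable.of_norm ((s3 ht).congr fun n => ?_)
  rw [norm_mul, norm_neg_one_zpow, one_mul, norm_of_nonneg (exp_pos _).le]

theorem th3_pos {t : ℝ} (ht : 0 < t) : 0 < th3 t :=
  (s3 ht).tsum_pos (fun _ => (exp_pos _).le) 0 (exp_pos _)

theorem th2_pos {t : ℝ} (ht : 0 < t) : 0 < th2 t :=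
  (s2 ht).tsum_pos (fun _ => (exp_pos _).le) 0 (exp_pos _)

theorem th3_inv {t : ℝ} (ht : 0 < t) : th3 (1 / t) = √t * th3 t := by
  have := Real.tsum_exp_neg_mul_int_sq ht
  unfold th3
  rw [this, ← sqrt_eq_rpow, ← mul_assoc, mul_one_div_cancel (sqrt_pos.2 ht).ne', one_mul]
  refine tsum_congr fun n => ?_
  congr 1
  ring

theorem th2_inv {t : ℝ} (ht : 0 < t) : th2 (1 / t) = √t * th4 t := by
  have := Complex.tsum_exp_neg_quadratic (a := (t : ℂ)) (by simpa using ht) (Complex.I / 2)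
  have e1 : (∑' n : ℤ, Complex.exp (-π * t * n ^ 2 + 2 * π * (Complex.I / 2) * n)) = (th4 t : ℂ) := by
    unfold th4
    rw [Complex.ofReal_tsum]
    refine tsum_congr fun n => ?_
    rw [Complex.exp_add, show 2 * π * (Complex.I / 2) * n = n * (π * Complex.I) by ring,
      Complex.exp_int_mul, Complex.exp_pi_mul_I]
    push_cast
    ring
  have e2 : (∑' n : ℤ, Complex.exp (-π / t * (n + Complex.I * (Complex.I / 2)) ^ 2)) = (th2 (1/t) : ℂ) := by
    unfold th2
    rw [Complex.ofReal_tsum, ← (Equiv.neg ℤ).tsum_eq]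
    refine tsum_congr fun n => ?_
    simp only [Equiv.neg_apply]
    push_cast
    congr 1
    rw [show Complex.I * (Complex.I / 2) = -1 / 2 by rw [← mul_div_assoc, Complex.I_mul_I]]
    ring
  rw [e1, e2] at this
  have e3 : (t : ℂ) ^ (1 / 2 : ℂ) = ((√t : ℝ) : ℂ) := by
    rw [sqrt_eq_rpow, Complex.ofReal_cpow ht.le]
    push_cast
    rfl
  rw [e3] at this
  have h2 : th4 t = 1 / √t * th2 (1/t) := by exact_mod_cast this
  rw [h2, ← mul_assoc, mul_one_div_cancel (sqrt_pos.2 ht).ne', one_mul]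

theorem th4_inv {t : ℝ} (ht : 0 < t) : th4 (1 / t) = √t * th2 t := by
  have h := th2_inv (t := 1 / t) (by positivity)
  rw [one_div_one_div] at h
  rw [h, ← mul_assoc, ← sqrt_mul ht.le, mul_one_div_cancel ht.ne', sqrt_one, one_mul]

theorem th4_pos {t : ℝ} (ht : 0 < t) : 0 < th4 t := by
  have h := th4_inv (t := 1 / t) (by positivity)
  rw [one_div_one_div] at h
  rw [h]
  exact mul_pos (sqrt_pos.2 (by positivity)) (th2_pos (by positivity))

theorem hasSum_split {β γ δ : Type} {f : β → ℝ} (e : γ → β) (o : δ → β)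
    (he : Function.Injective e) (ho : Function.Injective o)
    (hd : ∀ x y, e x ≠ o y) (hc : ∀ z, (∃ x, e x = z) ∨ ∃ y, o y = z) {S T : ℝ}
    (hS : HasSum (f ∘ e) S) (hT : HasSum (f ∘ o) T) : HasSum f (S + T) := by
  refine HasSum.add_isCompl (s := Set.range e) (t := Set.range o) ?_
    (he.hasSum_range_iff.2 hS) (ho.hasSum_range_iff.2 hT)
  constructor
  · rw [Set.disjoint_left]
    rintro _ ⟨x, rfl⟩ ⟨y, hy⟩
    exact hd x y hy.symm
  · rw [codisjoint_iff_le_sup]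
    intro z _
    exact hc z

theorem split_pair {f : ℤ × ℤ → ℝ} {S T : ℝ}
    (hS : HasSum (fun p : ℤ × ℤ => f (p.1 + p.2, p.1 - p.2)) S)
    (hT : HasSum (fun p : ℤ × ℤ => f (p.1 + p.2 + 1, p.1 - p.2)) T) : HasSum f (S + T) := by
  refine hasSum_split (fun p : ℤ × ℤ => (p.1 + p.2, p.1 - p.2))
    (fun p : ℤ × ℤ => (p.1 + p.2 + 1, p.1 - p.2)) ?_ ?_ ?_ ?_ hS hT
  · rintro ⟨a, b⟩ ⟨c, d⟩ h
    simp only [Prod.mk.injEq] at h ⊢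
    omega
  · rintro ⟨a, b⟩ ⟨c, d⟩ h
    simp only [Prod.mk.injEq] at h ⊢
    omega
  · rintro ⟨a, b⟩ ⟨c, d⟩ h
    simp only [Prod.mk.injEq] at h
    omega
  · rintro ⟨m, n⟩
    simp only [Prod.mk.injEq, Prod.exists]
    rcases Int.even_or_odd' (m + n) with ⟨k, hk | hk⟩
    · exact Or.inl ⟨k, m - k, by omega, by omega⟩
    · exact Or.inr ⟨k, m - k - 1, by omega, by omega⟩

theorem hasSum_mul' {f g : ℤ → ℝ} (hf : Summable f) (hg : Summable g) :
    HasSum (fun p : ℤ × ℤ => f p.1 * g p.2) ((∑' n, f n) * ∑' n, g n) :=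
  hf.hasSum.mul hg.hasSum (summable_mul_of_summable_norm hf.norm hg.norm)

theorem th3_sq {t : ℝ} (ht : 0 < t) : th3 t ^ 2 = th3 (2 * t) ^ 2 + th2 (2 * t) ^ 2 := by
  have ht2 : 0 < 2 * t := by positivity
  have h1 := hasSum_mul' (s3 ht) (s3 ht)
  have h2 := hasSum_mul' (s3 ht2) (s3 ht2)
  have h3 := hasSum_mul' (s2 ht2) (s2 ht2)
  rw [pow_two, pow_two, pow_two]
  refine h1.unique (split_pair ?_ ?_)
  · refine h2.congr_fun fun p => ?_
    simp only [← exp_add]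
    congr 1
    push_cast
    ring
  · refine h3.congr_fun fun p => ?_
    simp only [← exp_add]
    congr 1
    push_cast
    ring

theorem th4_sq {t : ℝ} (ht : 0 < t) : th4 t ^ 2 = th3 (2 * t) ^ 2 - th2 (2 * t) ^ 2 := by
  have ht2 : 0 < 2 * t := by positivity
  have h1 := hasSum_mul' (s4 ht) (s4 ht)
  have h2 := hasSum_mul' (s3 ht2) (s3 ht2)
  have h3 := hasSum_mul' (s2 ht2) (s2 ht2)
  rw [pow_two, pow_two, pow_two, sub_eq_add_neg]
  have hz : ∀ m n : ℤ, ∀ x y : ℝ, (-1 : ℝ) ^ m * x * ((-1) ^ n * y) = (-1) ^ (m + n) * (x * y) := by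
    intro m n x y
    rw [zpow_add₀ (by norm_num)]; ring
  refine h1.unique (split_pair ?_ ?_)
  · refine h2.congr_fun fun p => ?_
    rw [hz, Even.neg_one_zpow ⟨p.1, by ring⟩]
    simp only [← exp_add, one_mul]
    congr 1
    push_cast
    ring
  · refine h3.neg.congr_fun fun p => ?_
    rw [hz, Odd.neg_one_zpow ⟨p.1, by ring⟩]
    simp only [← exp_add, neg_mul, one_mul]
    congr 2
    push_cast
    ring

theorem split_int {f : ℤ → ℝ} {S T : ℝ}
    (hS : HasSum (fun p : ℤ => f (2 * p)) S)
    (hT : HasSum (fun p : ℤ => f (2 * p + 1)) T) : HasSum f (S + T) := by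
  refine hasSum_split (fun p : ℤ => 2 * p) (fun p : ℤ => 2 * p + 1) ?_ ?_ ?_ ?_ hS hT
  · intro a b h
    simp only at h
    omega
  · intro a b h
    simp only at h
    omega
  · intro a b h
    omega
  · intro m
    rcases Int.even_or_odd' m with ⟨k, hk | hk⟩
    · exact Or.inl ⟨k, by omega⟩
    · exact Or.inr ⟨k, by omega⟩

theorem th3_split {t : ℝ} (ht : 0 < t) : th3 t = th3 (4 * t) + th2 (4 * t) := by
  have ht2 : 0 < 4 * t := by positivity
  refine (s3 ht).hasSum.unique (split_int ?_ ?_)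
  · refine (s3 ht2).hasSum.congr_fun fun p => ?_
    congr 1
    push_cast
    ring
  · refine (s2 ht2).hasSum.congr_fun fun p => ?_
    congr 1
    push_cast
    ring

theorem th4_split {t : ℝ} (ht : 0 < t) : th4 t = th3 (4 * t) - th2 (4 * t) := by
  have ht2 : 0 < 4 * t := by positivity
  rw [sub_eq_add_neg]
  refine (s4 ht).hasSum.unique (split_int ?_ ?_)
  · refine (s3 ht2).hasSum.congr_fun fun p => ?_
    rw [Even.neg_one_zpow ⟨p, by ring⟩, one_mul]
    congr 1
    push_cast
    ring
  · refine (s2 ht2).hasSum.neg.congr_fun fun p => ?_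
    rw [Odd.neg_one_zpow ⟨p, by ring⟩, neg_one_mul]
    congr 2
    push_cast
    ring

theorem th_agm1 {t : ℝ} (ht : 0 < t) : th3 (2 * t) ^ 2 = (th3 t ^ 2 + th4 t ^ 2) / 2 := by
  rw [th3_sq ht, th4_sq ht]; ring

theorem th_agm2 {t : ℝ} (ht : 0 < t) : th4 (2 * t) ^ 2 = th3 t * th4 t := by
  rw [th4_sq (t := 2 * t) (by positivity), th3_split ht, th4_split ht,
    show 2 * (2 * t) = 4 * t by ring]
  ring

theorem th2_dup {t : ℝ} (ht : 0 < t) : th2 t ^ 2 = 2 * (th2 (2 * t) * th3 (2 * t)) := by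
  have h := th_agm2 (t := 1 / (2 * t)) (by positivity)
  rw [th3_inv (by positivity), th4_inv (by positivity), show 2 * (1 / (2 * t)) = 1 / t by field_simp,
    th4_inv ht, mul_pow, sq_sqrt ht.le] at h
  have h2 := mul_self_sqrt (show 0 ≤ 2 * t by positivity)
  have : t * th2 t ^ 2 = t * (2 * (th2 (2 * t) * th3 (2 * t))) := by
    rw [h]; linear_combination (th3 (2 * t) * th2 (2 * t)) * h2
  exact mul_left_cancel₀ ht.ne' this

theorem th_jacobi {t : ℝ} (ht : 0 < t) : th2 t ^ 4 + th4 t ^ 4 = th3 t ^ 4 := by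
  have h1 := th3_sq ht
  have h2 := th4_sq ht
  have h3 := th2_dup ht
  rw [show th2 t ^ 4 = (th2 t ^ 2) ^ 2 by ring, show th4 t ^ 4 = (th4 t ^ 2) ^ 2 by ring,
    show th3 t ^ 4 = (th3 t ^ 2) ^ 2 by ring, h1, h2, h3]
  ring

theorem th_lim {t : ℝ} (ht : 0 < t) (ε : ℤ → ℝ) (h0 : ε 0 = 1) (h1 : ∀ n, ‖ε n‖ = 1) :
    Tendsto (fun k : ℕ => ∑' n : ℤ, ε n * exp (-π * (2 ^ k * t) * (n : ℝ) ^ 2)) atTop (nhds 1) := by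
  have e : ∑' n : ℤ, (if n = 0 then (1 : ℝ) else 0) = 1 := tsum_ite_eq 0 _
  have hpi := pi_pos
  rw [← e]
  refine tendsto_tsum_of_dominated_convergence (s3 ht) ?_ ?_
  · intro n
    by_cases hn : n = 0
    · subst hn
      simp [h0]
    · rw [if_neg hn]
      have hn' : (0 : ℝ) < (n : ℝ) ^ 2 := by positivity
      rw [tendsto_zero_iff_norm_tendsto_zero]
      simp only [norm_mul, h1, one_mul, norm_of_nonneg (exp_pos _).le]
      refine tendsto_exp_atBot.comp ?_
      have := (tendsto_pow_atTop_atTop_of_one_lt (r := (2:ℝ)) (by norm_num)).const_mul_atTop_of_neg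
        (r := -(π * t * (n:ℝ) ^ 2)) (by rw [neg_lt_zero]; positivity)
      refine this.congr fun k => ?_
      ring
  · refine Eventually.of_forall fun k n => ?_
    rw [norm_mul, h1, one_mul, norm_of_nonneg (exp_pos _).le]
    refine exp_le_exp.2 ?_
    have : (1 : ℝ) ≤ 2 ^ k := one_le_pow₀ (by norm_num)
    have h : 0 ≤ π * t * (n:ℝ) ^ 2 := by positivity
    nlinarith

theorem Jint_theta {t : ℝ} (ht : 0 < t) : Jint (th3 t ^ 2) (th4 t ^ 2) = π / 2 := by
  have hp : ∀ n : ℕ, 0 < 2 ^ n * t := fun n => by positivity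
  have := Jint_lim (a := fun n => th3 (2 ^ n * t) ^ 2) (b := fun n => th4 (2 ^ n * t) ^ 2)
    (fun n => pow_pos (th3_pos (hp n)) 2) (fun n => pow_pos (th4_pos (hp n)) 2)
    (fun n => by
      rw [← th_agm1 (hp n)]; congr 2; ring)
    (fun n => by
      rw [← mul_pow, sqrt_sq (mul_pos (th3_pos (hp n)) (th4_pos (hp n))).le, ← th_agm2 (hp n)]
      congr 2; ring)
    (by
      have := (th_lim ht (fun _ => 1) rfl (by simp)).pow 2
      simpa [th3] using this)
    (by
      have := (th_lim ht (fun n => (-1) ^ n) (by simp) norm_neg_one_zpow).pow 2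
      simpa [th4] using this)
  simpa using this

theorem Jint_theta' {t : ℝ} (ht : 0 < t) : Jint (th3 t ^ 2) (th2 t ^ 2) = t * (π / 2) := by
  have h := Jint_theta (t := 1 / t) (by positivity)
  rw [th3_inv ht, th4_inv ht, mul_pow, mul_pow, sq_sqrt ht.le, Jint_scale ht] at h
  field_simp at h
  linarith

/-- the modulus is pinned down by its theta parametrisation -/
theorem modulus {t : ℝ} (ht : 0 < t) {k : ℝ} (hk0 : 0 < k) (hk1 : k < 1)
    (hK : Kint √(1 - k ^ 2) = t * Kint k) : √(1 - k ^ 2) * Kint k = π / 2 * th4 t ^ 2 := by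
  have p2 := th2_pos ht
  have p3 := th3_pos ht
  have p4 := th4_pos ht
  have hsq : 0 < 1 - k ^ 2 := by nlinarith
  have hk' : 0 < √(1 - k ^ 2) := sqrt_pos.2 hsq
  have hks : √(1 - k ^ 2) ^ 2 = 1 - k ^ 2 := sq_sqrt hsq.le
  rw [Kint_eq (k := k) (k' := √(1 - k ^ 2)) (by rw [hks]; ring)] at hK ⊢
  rw [Kint_eq (k' := k) (by rw [hks]; ring)] at hK
  set k' := √(1 - k ^ 2) with hkd
  set l := th2 t ^ 2 / th3 t ^ 2 with hl
  set l' := th4 t ^ 2 / th3 t ^ 2 with hl'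
  have l0 : 0 < l := by positivity
  have l0' : 0 < l' := by positivity
  have hll : l ^ 2 + l' ^ 2 = 1 := by
    have := th_jacobi ht
    rw [hl, hl']
    field_simp
    linarith
  have J1 : Jint 1 l' = th3 t ^ 2 * (π / 2) := by
    have h := Jint_theta ht
    have := Jint_scale (a := 1) (b := l') (c := th3 t ^ 2) (by positivity)
    rw [mul_one, show th3 t ^ 2 * l' = th4 t ^ 2 by rw [hl']; field_simp, h] at this
    rw [this]; field_simp
  have J2 : Jint 1 l = t * Jint 1 l' := by
    have h := Jint_theta' ht
    have := Jint_scale (a := 1) (b := l) (c := th3 t ^ 2) (by positivity)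
    rw [mul_one, show th3 t ^ 2 * l = th2 t ^ 2 by rw [hl]; field_simp, h] at this
    rw [J1]
    field_simp at this
    linarith
  have hkl : k' = l' := by
    rcases lt_trichotomy k' l' with h | h | h
    · exfalso
      have hs : l < k := by
        by_contra hcon
        push Not at hcon
        nlinarith
      have a1 := Jint_strict hk' h
      have a2 := Jint_strict l0 hs
      nlinarith
    · exact h
    · exfalso
      have hs : k < l := by
        by_contra hcon
        push Not at hcon
        nlinarith
      have a1 := Jint_strict l0' h
      have a2 := Jint_strict hk0 hs
      nlinarith
  rw [hkl, J1, hl']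
  field_simp

theorem th4_gauss {t : ℝ} (ht : 0 < t) :
    Tendsto (fun n => Pp (exp (-π * t)) n) atTop (nhds (th4 t)) := by
  set q := exp (-π * t) with hq
  have h0 : 0 < q := exp_pos _
  have h1 : q < 1 := by
    rw [hq, exp_lt_one_iff]
    have := mul_pos pi_pos ht
    linarith
  have hs := (s4 ht).hasSum.nat_add_neg
  have hs2 := (hasSum_nat_add_iff' 1).2 hs
  have hs3 := hs2.tendsto_sum_nat
  have hterm : ∀ s : ℕ, (-1 : ℝ) ^ ((s + 1 : ℕ) : ℤ) * exp (-π * t * (((s + 1 : ℕ) : ℤ) : ℝ) ^ 2) +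
      (-1 : ℝ) ^ (-((s + 1 : ℕ) : ℤ)) * exp (-π * t * ((-((s + 1 : ℕ) : ℤ) : ℤ) : ℝ) ^ 2) =
      2 * ((-1) ^ (s + 1) * q ^ ((s + 1) ^ 2)) := by
    intro s
    have e : q ^ ((s + 1) ^ 2) = exp (-π * t * ((s : ℝ) + 1) ^ 2) := by
      rw [hq, ← exp_nat_mul]
      congr 1
      push_cast
      ring
    rw [e, zpow_neg, zpow_natCast]
    have : ((-1 : ℝ) ^ (s + 1))⁻¹ = (-1) ^ (s + 1) := by
      rw [← inv_pow]; norm_num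
    rw [this]
    push_cast
    rw [neg_sq]
    ring
  simp only [hterm] at hs3
  have hlim : Tendsto (fun n => 1 + 2 * ∑ s ∈ Finset.range n, (-1 : ℝ) ^ (s + 1) * q ^ ((s + 1) ^ 2)) atTop
      (nhds (th4 t)) := by
    have := hs3.const_add 1
    simp only [← Finset.mul_sum] at this
    convert this using 2
    unfold th4
    simp
  have := hlim.sub (shanks_lim h0 h1)
  simpa using this

end PartD

theorem Gf_pow {q : ℝ} (h0 : 0 < q) (h1 : q < 1) (N : ℕ) :
    Gf q (q ^ (N + 1)) = Pp q N * Gf q q := by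
  induction N with
  | zero => simp [Pp]
  | succ N ih =>
    have hlt : q ^ (N + 1) < 1 := pow_lt_one₀ h0.le h1 (by omega)
    have f := Gf_func h0 h1 (a := q ^ (N + 1)) (by rwa [abs_of_pos (by positivity)])
    rw [← pow_succ', ih] at f
    have hp : 1 + q ^ (N + 1) ≠ 0 := by positivity
    rw [Pp]
    field_simp
    linarith

theorem th4_mul_Gf {t : ℝ} (ht : 0 < t) :
    th4 t * Gf (Real.exp (-Real.pi * t)) (Real.exp (-Real.pi * t)) = 1 := by
  have hg := th4_gauss ht
  set q := Real.exp (-Real.pi * t) with hq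
  have h0 : 0 < q := Real.exp_pos _
  have h1 : q < 1 := by
    rw [hq, Real.exp_lt_one_iff]
    have := mul_pos Real.pi_pos ht
    linarith
  have l := Gf_tendsto h0 h1 (a := q) (by rwa [abs_of_pos h0])
  simp only [← pow_succ, Gf_pow h0 h1] at l
  exact tendsto_nhds_unique (hg.mul_const _) l

theorem exp_arctanh_sum {q : ℝ} (h0 : 0 < q) (h1 : q < 1) (n : ℕ) :
    Real.exp (-4 * ∑ j ∈ Finset.range n, arctanh (q ^ (j + 1))) = Pp q n ^ 2 := by
  induction n with
  | zero => simp [Pp]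
  | succ n ih =>
    rw [Finset.sum_range_succ, mul_add, Real.exp_add, ih, Pp, mul_pow]
    congr 1
    have hm := one_sub_pow_pos h0 h1 n
    have hp : 0 < 1 + q ^ (n + 1) := by positivity
    have hx : 0 < (1 - q ^ (n + 1)) / (1 + q ^ (n + 1)) := by positivity
    have : -4 * arctanh (q ^ (n + 1)) = Real.log ((1 - q ^ (n + 1)) / (1 + q ^ (n + 1))) +
        Real.log ((1 - q ^ (n + 1)) / (1 + q ^ (n + 1))) := by
      rw [arctanh, Real.log_div hp.ne' hm.ne', Real.log_div hm.ne' hp.ne']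
      ring
    rw [this, Real.exp_add, Real.exp_log hx, pow_two]

/-- Proposition 8: for `q = e^{-π√r}` and every positive integer `ν`, the continued fraction
`u(q^ν, q)` converges to some `L ≠ 1` and
`-1 + 2/(1 - u(q^ν,q)) = (π/(2 k'_r K(k_r))) exp(-4 ∑_{j=1}^{ν-1} arctanh(qʲ))`. -/
theorem stmt_12 (r : ℝ) (hr : 0 < r) (q : ℝ) (hq : q = Real.exp (-Real.pi * Real.sqrt r))
    (k : ℝ) (hk0 : 0 < k) (hk1 : k < 1)
    (hK : Kint (Real.sqrt (1 - k ^ 2)) = Real.sqrt r * Kint k)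
    (ν : ℕ) (hν : 1 ≤ ν) :
    ∃ L : ℝ,
      CFTendsto
        (fun n => if n = 1 then 2 * q ^ ν
          else (q ^ ν) ^ 2 * q ^ (n - 2) * (1 + q ^ (n - 1)) ^ 2)
        (fun n => 1 - q ^ (2 * n - 1)) L ∧
      L ≠ 1 ∧
      -1 + 2 / (1 - L) =
        Real.pi / (2 * Real.sqrt (1 - k ^ 2) * Kint k) *
          Real.exp (-4 * ∑ j ∈ Finset.range (ν - 1), arctanh (q ^ (j + 1))) := by
  have ht : 0 < Real.sqrt r := Real.sqrt_pos.2 hr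
  have h0 : 0 < q := hq ▸ Real.exp_pos _
  have h1 : q < 1 := by
    rw [hq, Real.exp_lt_one_iff]
    have := mul_pos Real.pi_pos ht
    linarith
  obtain ⟨L, hL, hL1, hL2⟩ := cf_main h0 h1 (a := q ^ ν) (by positivity)
    (pow_lt_one₀ h0.le h1 (by omega))
  refine ⟨L, hL, hL1, ?_⟩
  obtain ⟨n, rfl⟩ : ∃ n, ν = n + 1 := ⟨ν - 1, by omega⟩
  have hm := modulus ht hk0 hk1 hK
  have hG := th4_mul_Gf ht
  rw [← hq] at hG
  have p4 := th4_pos ht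
  have hG' : Gf q q = 1 / th4 (Real.sqrt r) := by
    field_simp
    linarith
  rw [hL2, Gf_pow h0 h1, Nat.add_sub_cancel, exp_arctanh_sum h0 h1, mul_assoc 2, hm, hG']
  have := Real.pi_pos
  field_simp
end

section
/- Let r > 0, set q = e^{−π√r}, and assume k_r ∈ (0,1) satisfies K(√(1 − k_r²)) = √r · K(k_r). Then for every integer ν ≥ 0, ((−q^{ν+1/2};q)_∞/(q^{ν+1/2};q)_∞)² = exp( arctanh(k_r) − 4·∑_{j=0}^{ν−1} arctanh(q^{j+1/2}) ), where the finite sum is empty (equal to 0) when ν = 0. -/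
/-- The q-Pochhammer infinite product `(a; q)_∞ = ∏_{n=0}^∞ (1 - a qⁿ)`. -/
noncomputable def qPoch (a q : ℝ) : ℝ := ∏' n : ℕ, (1 - a * q ^ n)
open Filter Topology

/-- Symmetric elliptic integral. -/
noncomputable def agI (a b : ℝ) : ℝ :=
  ∫ t in (0 : ℝ)..(Real.pi / 2),
    1 / Real.sqrt (a ^ 2 * Real.cos t ^ 2 + b ^ 2 * Real.sin t ^ 2)

lemma agI_pos_aux {a b : ℝ} (ha : 0 < a) (hb : 0 < b) (t : ℝ) :
    0 < a ^ 2 * Real.cos t ^ 2 + b ^ 2 * Real.sin t ^ 2 := by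
  have h := Real.sin_sq_add_cos_sq t
  rcases eq_or_ne (Real.cos t) 0 with h0 | h0
  · have : Real.sin t ^ 2 = 1 := by rw [h0] at h; linarith
    rw [this, h0]; positivity
  · positivity

lemma agI_cont {a b : ℝ} (ha : 0 < a) (hb : 0 < b) :
    Continuous (fun t : ℝ => 1 / Real.sqrt (a ^ 2 * Real.cos t ^ 2 + b ^ 2 * Real.sin t ^ 2)) := by
  refine Continuous.div continuous_const (by fun_prop) ?_
  intro t
  exact (Real.sqrt_pos.2 (agI_pos_aux ha hb t)).ne'

lemma agI_smul {a b c : ℝ} (hc : 0 < c) : agI (c * a) (c * b) = c⁻¹ * agI a b := by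
  unfold agI
  rw [← intervalIntegral.integral_const_mul]
  congr 1
  ext t
  rw [show (c * a) ^ 2 * Real.cos t ^ 2 + (c * b) ^ 2 * Real.sin t ^ 2
    = c ^ 2 * (a ^ 2 * Real.cos t ^ 2 + b ^ 2 * Real.sin t ^ 2) by ring,
    Real.sqrt_mul (by positivity), Real.sqrt_sq hc.le, one_div, one_div, mul_inv]

lemma Kint_eq_agI (x : ℝ) (hx : 0 ≤ 1 - x ^ 2) : Kint x = agI 1 (Real.sqrt (1 - x ^ 2)) := by
  unfold Kint agI
  congr 1
  ext t
  rw [Real.sq_sqrt hx]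
  congr 2
  linarith [Real.sin_sq_add_cos_sq t]

lemma agI_double {a b : ℝ} (ha : 0 < a) (hb : 0 < b) :
    ∫ t in (0 : ℝ)..Real.pi,
      1 / Real.sqrt (a ^ 2 * Real.cos t ^ 2 + b ^ 2 * Real.sin t ^ 2) = 2 * agI a b := by
  have hc := agI_cont ha hb
  rw [← intervalIntegral.integral_add_adjacent_intervals (b := Real.pi / 2)
    (hc.intervalIntegrable _ _) (hc.intervalIntegrable _ _)]
  have := intervalIntegral.integral_comp_sub_left (a := 0) (b := Real.pi / 2)
    (fun t : ℝ => 1 / Real.sqrt (a ^ 2 * Real.cos t ^ 2 + b ^ 2 * Real.sin t ^ 2)) Real.pi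
  simp only [Real.cos_pi_sub, Real.sin_pi_sub, neg_sq, sub_zero] at this
  rw [show Real.pi - Real.pi / 2 = Real.pi / 2 by ring] at this
  rw [← this]
  unfold agI
  ring

lemma agI_step {a b : ℝ} (ha : 0 < a) (hb : 0 < b) :
    agI ((a + b) / 2) (Real.sqrt (a * b)) = agI a b := by
  have hab : 0 < Real.sqrt (a * b) := Real.sqrt_pos.2 (by positivity)
  have ha1 : 0 < (a + b) / 2 := by positivity
  have hD : ∀ t, 0 < a * Real.cos t ^ 2 + b * Real.sin t ^ 2 := by
    intro t
    have := agI_pos_aux (Real.sqrt_pos.2 ha) (Real.sqrt_pos.2 hb) t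
    rwa [Real.sq_sqrt ha.le, Real.sq_sqrt hb.le] at this
  set g : ℝ → ℝ := fun t => 1 / Real.sqrt (((a + b) / 2) ^ 2 * Real.cos t ^ 2
    + (Real.sqrt (a * b)) ^ 2 * Real.sin t ^ 2) with hg
  set f : ℝ → ℝ := fun t => 2 * t - Real.arctan ((a - b) * (Real.sin t * Real.cos t) /
    (a * Real.cos t ^ 2 + b * Real.sin t ^ 2)) with hf
  set f' : ℝ → ℝ := fun t => 1 + a * b / (a ^ 2 * Real.cos t ^ 2 + b ^ 2 * Real.sin t ^ 2) with hf'
  have hDD : ∀ t, (a * Real.cos t ^ 2 + b * Real.sin t ^ 2) ^ 2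
      + ((a - b) * (Real.sin t * Real.cos t)) ^ 2
      = a ^ 2 * Real.cos t ^ 2 + b ^ 2 * Real.sin t ^ 2 := by
    intro t
    have h : Real.cos t ^ 2 = 1 - Real.sin t ^ 2 := by linarith [Real.sin_sq_add_cos_sq t]
    linear_combination (a ^ 2 * Real.cos t ^ 2 + b ^ 2 * Real.sin t ^ 2) * h
  have hder : ∀ t, HasDerivAt f (f' t) t := by
    intro t
    have hs := Real.hasDerivAt_sin t
    have hc := Real.hasDerivAt_cos t
    have h1 := ((hs.mul hc).const_mul (a - b)).div
      (((hc.pow 2).const_mul a).add ((hs.pow 2).const_mul b)) (hD t).ne'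
    have h2 := ((hasDerivAt_id t).const_mul 2).sub h1.arctan
    convert! h2 using 1
    have h := Real.sin_sq_add_cos_sq t
    have h3 := hDD t
    have h4 := agI_pos_aux ha hb t
    have h5 := hD t
    simp only [hf', Pi.mul_apply, Pi.add_apply, Pi.pow_apply, Nat.cast_ofNat, Pi.div_apply]
    set s := Real.sin t
    set c := Real.cos t
    have h6 : 1 + ((a - b) * (s * c) / (a * c ^ 2 + b * s ^ 2)) ^ 2
      = (a ^ 2 * c ^ 2 + b ^ 2 * s ^ 2) / (a * c ^ 2 + b * s ^ 2) ^ 2 := by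
      rw [← h3]; field_simp
    rw [h6]
    field_simp
    have hc2 : c ^ 2 = 1 - s ^ 2 := by linarith
    have hc4 : c ^ 4 = (1 - s ^ 2) ^ 2 := by rw [← hc2]; ring
    ring_nf
    simp only [hc2, hc4]
    ring
  have hcont : Continuous g := agI_cont ha1 hab
  have hf'c : Continuous f' := by
    refine continuous_const.add (Continuous.div continuous_const (by fun_prop) ?_)
    intro t; exact (agI_pos_aux ha hb t).ne'
  have key := intervalIntegral.integral_comp_mul_deriv (a := 0) (b := Real.pi / 2) (f := f)
    (f' := f') (g := g) (fun x _ => hder x) hf'c.continuousOn hcont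
  have e0 : f 0 = 0 := by simp [hf]
  have e1 : f (Real.pi / 2) = Real.pi := by simp [hf]; ring
  rw [e0, e1, agI_double ha1 hab] at key
  have : ∀ t, (g ∘ f) t * f' t
      = 2 * (1 / Real.sqrt (a ^ 2 * Real.cos t ^ 2 + b ^ 2 * Real.sin t ^ 2)) := by
    intro t
    have h := Real.sin_sq_add_cos_sq t
    have h3 := hDD t
    have h4 := agI_pos_aux ha hb t
    have h5 := hD t
    set s := Real.sin t with hsdef
    set c := Real.cos t with hcdef
    set Δ := Real.sqrt (a ^ 2 * c ^ 2 + b ^ 2 * s ^ 2) with hΔ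
    have hΔp : 0 < Δ := Real.sqrt_pos.2 h4
    have hΔ2 : a ^ 2 * c ^ 2 + b ^ 2 * s ^ 2 = Δ ^ 2 := (Real.sq_sqrt h4.le).symm
    have h6 : Real.sqrt (1 + ((a - b) * (s * c) / (a * c ^ 2 + b * s ^ 2)) ^ 2)
      = Δ / (a * c ^ 2 + b * s ^ 2) := by
      rw [show 1 + ((a - b) * (s * c) / (a * c ^ 2 + b * s ^ 2)) ^ 2
        = (a ^ 2 * c ^ 2 + b ^ 2 * s ^ 2) / (a * c ^ 2 + b * s ^ 2) ^ 2 by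
          rw [← h3]; field_simp]
      rw [Real.sqrt_div h4.le, Real.sqrt_sq h5.le]
    have hca : Real.cos (Real.arctan ((a - b) * (s * c) / (a * c ^ 2 + b * s ^ 2)))
        = (a * c ^ 2 + b * s ^ 2) / Δ := by
      rw [Real.cos_arctan, h6, one_div_div]
    have hsa : Real.sin (Real.arctan ((a - b) * (s * c) / (a * c ^ 2 + b * s ^ 2)))
        = (a - b) * (s * c) / Δ := by
      rw [Real.sin_arctan, h6, div_div_div_cancel_right₀ h5.ne']
    have hcos : Real.cos (f t) = (a * c ^ 2 - b * s ^ 2) / Δ := by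
      simp only [hf]
      rw [Real.cos_sub, Real.cos_two_mul, Real.sin_two_mul, ← hsdef, ← hcdef, hca, hsa]
      field_simp
      linear_combination (2 * a * c ^ 2) * h
    have hsin : Real.sin (f t) = (a + b) * (s * c) / Δ := by
      simp only [hf]
      rw [Real.sin_sub, Real.cos_two_mul, Real.sin_two_mul, ← hsdef, ← hcdef, hca, hsa]
      field_simp
      linear_combination (2 * b * s * c) * h
    have hE : ((a + b) / 2) ^ 2 * Real.cos (f t) ^ 2
        + (Real.sqrt (a * b)) ^ 2 * Real.sin (f t) ^ 2
        = ((a + b) * (a * c ^ 2 + b * s ^ 2) / (2 * Δ)) ^ 2 := by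
      rw [hcos, hsin, Real.sq_sqrt (by positivity)]
      field_simp
      ring
    have hf't : f' t = (a + b) * (a * c ^ 2 + b * s ^ 2) / Δ ^ 2 := by
      simp only [hf']
      rw [← hsdef, ← hcdef, hΔ2, eq_div_iff (by positivity), add_mul, div_mul_cancel₀ _ (by positivity), ← hΔ2]
      linear_combination (-(a * b)) * h
    simp only [Function.comp, hg]
    rw [hE, Real.sqrt_sq (by positivity), hf't]
    field_simp
  simp_rw [this] at key
  rw [intervalIntegral.integral_const_mul] at key
  unfold agI at key ⊢
  linarith

lemma agI_one : agI 1 1 = Real.pi / 2 := by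
  unfold agI
  simp

lemma agI_anti {a b c d : ℝ} (ha : 0 < a) (hb : 0 < b) (hac : a ≤ c) (hbd : b ≤ d) :
    agI c d ≤ agI a b := by
  unfold agI
  have hc := ha.trans_le hac
  have hd := hb.trans_le hbd
  apply intervalIntegral.integral_mono_on (by positivity)
    ((agI_cont hc hd).intervalIntegrable _ _) ((agI_cont ha hb).intervalIntegrable _ _)
  intro t _
  apply one_div_le_one_div_of_le (Real.sqrt_pos.2 (agI_pos_aux ha hb t))
  apply Real.sqrt_le_sqrt
  gcongr

lemma agI_strict {a b d : ℝ} (ha : 0 < a) (hb : 0 < b) (hbd : b < d) :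
    agI a d < agI a b := by
  unfold agI
  have hd := hb.trans hbd
  apply intervalIntegral.integral_lt_integral_of_continuousOn_of_le_of_exists_lt (by positivity)
    (agI_cont ha hd).continuousOn (agI_cont ha hb).continuousOn
  · intro t _
    apply one_div_le_one_div_of_le (Real.sqrt_pos.2 (agI_pos_aux ha hb t))
    apply Real.sqrt_le_sqrt
    gcongr
  · refine ⟨Real.pi / 2, ⟨by positivity, le_rfl⟩, ?_⟩
    simp only [Real.cos_pi_div_two, Real.sin_pi_div_two]
    apply one_div_lt_one_div_of_lt (Real.sqrt_pos.2 (by positivity))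
    apply Real.sqrt_lt_sqrt (by positivity)
    nlinarith

/-- An AGM sequence tending to 1 has integral π/2. -/
lemma agI_limit (a b : ℕ → ℝ) (ha : ∀ n, 0 < a n) (hb : ∀ n, 0 < b n)
    (h1 : ∀ n, a (n + 1) = (a n + b n) / 2) (h2 : ∀ n, b (n + 1) = Real.sqrt (a n * b n))
    (la : Tendsto a atTop (𝓝 1)) (lb : Tendsto b atTop (𝓝 1)) :
    agI (a 0) (b 0) = Real.pi / 2 := by
  have hconst : ∀ n, agI (a n) (b n) = agI (a 0) (b 0) := by
    intro n
    induction n with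
    | zero => rfl
    | succ n ih => rw [h1, h2, agI_step (ha n) (hb n), ih]
  have hdiag : ∀ c : ℝ, 0 < c → agI c c = c⁻¹ * (Real.pi / 2) := by
    intro c hc
    have := agI_smul (a := 1) (b := 1) hc
    rwa [mul_one, agI_one] at this
  have lmax : Tendsto (fun n => (max (a n) (b n))⁻¹ * (Real.pi / 2)) atTop (𝓝 (Real.pi / 2)) := by
    have := ((la.max lb).inv₀ (by simp)).mul_const (Real.pi / 2)
    simpa using this
  have lmin : Tendsto (fun n => (min (a n) (b n))⁻¹ * (Real.pi / 2)) atTop (𝓝 (Real.pi / 2)) := by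
    have := ((la.min lb).inv₀ (by simp)).mul_const (Real.pi / 2)
    simpa using this
  apply le_antisymm
  · refine ge_of_tendsto' lmin fun n => ?_
    rw [← hconst n, ← hdiag _ (lt_min (ha n) (hb n))]
    exact agI_anti (lt_min (ha n) (hb n)) (lt_min (ha n) (hb n)) (min_le_left _ _) (min_le_right _ _)
  · refine le_of_tendsto' lmax fun n => ?_
    rw [← hconst n, ← hdiag _ (lt_max_of_lt_left (ha n))]
    exact agI_anti (ha n) (hb n) (le_max_left _ _) (le_max_right _ _)

/-- Theta series `∑ p^(n²)`. -/
noncomputable def th (p : ℝ) : ℝ := ∑' n : ℤ, p ^ (n ^ 2)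
/-- Theta series `∑ p^(n²+n)`. -/
noncomputable def tt (p : ℝ) : ℝ := ∑' n : ℤ, p ^ (n ^ 2 + n)

lemma th_summable_norm {p : ℝ} (h1 : |p| < 1) : Summable (fun n : ℤ => ‖p ^ (n ^ 2)‖) := by
  have hg := summable_geometric_of_lt_one (abs_nonneg p) h1
  have hb : ∀ n : ℕ, ‖p ^ ((n : ℤ) ^ 2)‖ ≤ |p| ^ n := by
    intro n
    rw [← Nat.cast_pow, zpow_natCast, norm_pow, Real.norm_eq_abs]
    exact pow_le_pow_of_le_one (abs_nonneg p) h1.le (Nat.le_self_pow (by norm_num) n)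
  apply Summable.of_nat_of_neg
  · exact Summable.of_nonneg_of_le (fun n => norm_nonneg _) hb hg
  · refine Summable.of_nonneg_of_le (fun n => norm_nonneg _) (fun n => ?_) hg
    rw [neg_sq]; exact hb n

lemma tt_summable {p : ℝ} (h1 : |p| < 1) : Summable (fun n : ℤ => ‖p ^ (n ^ 2 + n)‖) := by
  have hg := summable_geometric_of_lt_one (abs_nonneg p) h1
  apply Summable.of_nat_of_neg_add_one
  · refine Summable.of_nonneg_of_le (fun n => norm_nonneg _) (fun n => ?_) hg
    rw [show ((n : ℤ) ^ 2 + n) = ((n ^ 2 + n : ℕ) : ℤ) by push_cast; ring, zpow_natCast, norm_pow,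
      Real.norm_eq_abs]
    exact pow_le_pow_of_le_one (abs_nonneg p) h1.le (by omega)
  · refine Summable.of_nonneg_of_le (fun n => norm_nonneg _) (fun n => ?_) hg
    rw [show ((-((n : ℤ) + 1)) ^ 2 + (-((n : ℤ) + 1))) = ((n ^ 2 + n : ℕ) : ℤ) by
      push_cast; ring, zpow_natCast, norm_pow, Real.norm_eq_abs]
    exact pow_le_pow_of_le_one (abs_nonneg p) h1.le (by omega)

/-- Splitting of the lattice `ℤ²` by the parity of `m + n`. -/
noncomputable def latEquiv : (ℤ × ℤ) ⊕ (ℤ × ℤ) ≃ ℤ × ℤ :=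
  Equiv.ofBijective (Sum.elim (fun x => (x.1 + x.2, x.1 - x.2))
    (fun x => (x.1 + x.2 + 1, x.1 - x.2))) (by
  constructor
  · rintro (⟨a, b⟩ | ⟨a, b⟩) (⟨c, d⟩ | ⟨c, d⟩) h <;>
      simp only [Sum.elim_inl, Sum.elim_inr, Prod.mk.injEq] at h
    · have h1 : a = c := by omega
      have h2 : b = d := by omega
      rw [h1, h2]
    · omega
    · omega
    · have h1 : a = c := by omega
      have h2 : b = d := by omega
      rw [h1, h2]
  · rintro ⟨m, n⟩
    rcases Int.even_or_odd' (m + n) with ⟨c, hc | hc⟩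
    · refine ⟨Sum.inl (c, m - c), ?_⟩
      simp only [Sum.elim_inl, Prod.mk.injEq]
      omega
    · refine ⟨Sum.inr (c, m - c - 1), ?_⟩
      simp only [Sum.elim_inr, Prod.mk.injEq]
      omega)

lemma lat_split {F : ℤ × ℤ → ℝ} (hF : Summable F) :
    ∑' x, F x = (∑' x : ℤ × ℤ, F (x.1 + x.2, x.1 - x.2))
      + ∑' x : ℤ × ℤ, F (x.1 + x.2 + 1, x.1 - x.2) := by
  rw [← latEquiv.tsum_eq]
  have hs := latEquiv.summable_iff.2 hF
  rw [Summable.tsum_sum]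
  · rfl
  · exact hs.comp_injective Sum.inl_injective
  · exact hs.comp_injective Sum.inr_injective

lemma abs_sq_lt {p : ℝ} (h1 : |p| < 1) : |p ^ 2| < 1 := by
  rw [abs_pow]; exact pow_lt_one₀ (abs_nonneg p) h1 (by norm_num)

lemma th_sq {p : ℝ} (h0 : p ≠ 0) (h1 : |p| < 1) :
    th p ^ 2 = th (p ^ 2) ^ 2 + p * tt (p ^ 2) ^ 2 := by
  have hs := th_summable_norm h1
  have hs2 := th_summable_norm (abs_sq_lt h1)
  have ht2 := tt_summable (abs_sq_lt h1)
  rw [sq, sq, sq (tt _)]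
  unfold th tt
  rw [tsum_mul_tsum_of_summable_norm hs hs, lat_split (summable_mul_of_summable_norm hs hs),
    tsum_mul_tsum_of_summable_norm hs2 hs2, tsum_mul_tsum_of_summable_norm ht2 ht2,
    ← tsum_mul_left]
  congr 1
  · apply tsum_congr
    rintro ⟨a, b⟩
    simp only
    rw [← zpow_add₀ h0, ← zpow_natCast p 2, ← zpow_mul, ← zpow_mul, ← zpow_add₀ h0]
    congr 1
    push_cast; ring
  · apply tsum_congr
    rintro ⟨a, b⟩
    simp only
    rw [← zpow_add₀ h0, ← zpow_natCast p 2, ← zpow_mul, ← zpow_mul, ← zpow_add₀ h0,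
      ← zpow_one_add₀ h0]
    congr 1
    push_cast; ring

lemma neg_zpow_sq (p : ℝ) (n : ℤ) : (-p) ^ (n ^ 2) = (-1) ^ n * p ^ (n ^ 2) := by
  rcases Int.even_or_odd n with h | h
  · rw [(h.pow_of_ne_zero two_ne_zero).neg_zpow, h.neg_one_zpow, one_mul]
  · rw [h.pow.neg_zpow, h.neg_one_zpow, neg_one_mul]

/-- The reflection used to cancel the odd part. -/
def oddRefl : ℤ × ℤ ≃ ℤ × ℤ where
  toFun := fun x => (x.1, -1 - x.2)
  invFun := fun x => (x.1, -1 - x.2)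
  left_inv := fun x => by simp
  right_inv := fun x => by simp

lemma odd_cancel (p : ℝ) :
    ∑' x : ℤ × ℤ, p ^ ((x.1 + x.2 + 1) ^ 2) * (-p) ^ ((x.1 - x.2) ^ 2) = 0 := by
  have hm1 : (-1 : ℝ) ≠ 0 := by norm_num
  have h := oddRefl.tsum_eq
    (fun x : ℤ × ℤ => p ^ ((x.1 + x.2 + 1) ^ 2) * (-p) ^ ((x.1 - x.2) ^ 2))
  have h2 : ∀ x : ℤ × ℤ, p ^ (((oddRefl x).1 + (oddRefl x).2 + 1) ^ 2)
      * (-p) ^ (((oddRefl x).1 - (oddRefl x).2) ^ 2)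
      = -(p ^ ((x.1 + x.2 + 1) ^ 2) * (-p) ^ ((x.1 - x.2) ^ 2)) := by
    rintro ⟨a, b⟩
    change p ^ ((a + (-1 - b) + 1) ^ 2) * (-p) ^ ((a - (-1 - b)) ^ 2)
      = -(p ^ ((a + b + 1) ^ 2) * (-p) ^ ((a - b) ^ 2))
    have hz : (-1 : ℝ) ^ (a + b + 1) = - (-1) ^ (a - b) := by
      rw [show a + b + 1 = (a - b) + (2 * b + 1) by ring, zpow_add₀ hm1,
        Odd.neg_one_zpow (n := 2 * b + 1) ⟨b, rfl⟩]
      ring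
    rw [neg_zpow_sq, neg_zpow_sq, show a + (-1 - b) + 1 = a - b by ring,
        show a - (-1 - b) = a + b + 1 by ring, hz]
    ring
  rw [tsum_congr h2, tsum_neg] at h
  linarith

lemma th_mul {p : ℝ} (h0 : p ≠ 0) (h1 : |p| < 1) :
    th p * th (-p) = th (-p ^ 2) ^ 2 := by
  have h1' : |-p| < 1 := by rwa [abs_neg]
  have hs := th_summable_norm h1
  have hs' := th_summable_norm h1'
  have h2' : |(-p ^ 2)| < 1 := by
    rw [abs_neg]; exact abs_sq_lt h1
  have hs2 := th_summable_norm h2'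
  have hss := summable_mul_of_summable_norm hs hs'
  have hl := lat_split hss
  beta_reduce at hl
  have hm1 : (-1 : ℝ) ≠ 0 := by norm_num
  rw [sq (th _)]
  unfold th
  rw [tsum_mul_tsum_of_summable_norm hs hs', hl,
    tsum_mul_tsum_of_summable_norm hs2 hs2, odd_cancel p, add_zero]
  apply tsum_congr
  rintro ⟨a, b⟩
  change p ^ ((a + b) ^ 2) * (-p) ^ ((a - b) ^ 2) = (-p ^ 2) ^ (a ^ 2) * (-p ^ 2) ^ (b ^ 2)
  have hb : ((-1 : ℝ) ^ b)⁻¹ = (-1) ^ b := by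
    rcases Int.even_or_odd b with h | h <;> rw [h.neg_one_zpow] <;> norm_num
  have hz : (-1 : ℝ) ^ (a - b) = (-1) ^ a * (-1) ^ b := by
    rw [sub_eq_add_neg, zpow_add₀ hm1, zpow_neg, hb]
  rw [neg_zpow_sq, neg_zpow_sq, neg_zpow_sq, hz]
  have : p ^ ((a + b) ^ 2) * p ^ ((a - b) ^ 2) = (p ^ 2) ^ (a ^ 2) * (p ^ 2) ^ (b ^ 2) := by
    rw [← zpow_add₀ h0, ← zpow_natCast p 2, ← zpow_mul, ← zpow_mul, ← zpow_add₀ h0]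
    congr 1
    push_cast; ring
  generalize (-1 : ℝ) ^ a = u
  generalize (-1 : ℝ) ^ b = v
  generalize p ^ ((a + b) ^ 2) = x at *
  generalize p ^ ((a - b) ^ 2) = y at *
  generalize (p ^ 2) ^ (a ^ 2) = z at *
  generalize (p ^ 2) ^ (b ^ 2) = w at *
  linear_combination (u * v) * this

lemma th_pos {p : ℝ} (h0 : 0 < p) (h1 : p < 1) : 0 < th p := by
  have hs := (th_summable_norm (p := p) (by rwa [abs_of_pos h0])).of_norm
  exact hs.tsum_pos (fun n => (zpow_pos h0 _).le) 0 (zpow_pos h0 _)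

lemma tt_pos {p : ℝ} (h0 : 0 < p) (h1 : p < 1) : 0 < tt p := by
  have hs := (tt_summable (p := p) (by rwa [abs_of_pos h0])).of_norm
  exact hs.tsum_pos (fun n => (zpow_pos h0 _).le) 0 (zpow_pos h0 _)

/-- `th p → 1` as `p → 0`. -/
lemma th_tendsto (u : ℕ → ℝ) (hl : Tendsto u atTop (𝓝 0)) :
    Tendsto (fun n => th (u n)) atTop (𝓝 1) := by
  have hb := th_summable_norm (p := 1 / 2) (by rw [abs_of_pos] <;> norm_num)
  have key := tendsto_tsum_of_dominated_convergence (𝓕 := atTop)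
    (f := fun n (k : ℤ) => u n ^ (k ^ 2)) (g := fun k : ℤ => if k = 0 then (1 : ℝ) else 0) hb ?_ ?_
  · rw [tsum_ite_eq] at key
    exact key
  · intro k
    by_cases hk : k = 0
    · simp [hk]
    · simp only [hk, if_false]
      obtain ⟨m, hm⟩ : ∃ m : ℕ, k ^ 2 = (m : ℤ) := ⟨(k ^ 2).toNat, by
        rw [Int.toNat_of_nonneg (sq_nonneg k)]⟩
      have hm0 : m ≠ 0 := by
        rintro rfl
        apply hk
        simpa using hm
      simp only [hm, zpow_natCast]
      have := hl.pow m
      rwa [zero_pow hm0] at this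
  · have hu : ∀ᶠ n in atTop, |u n| < 1 / 2 := by
      have := hl.abs
      rw [abs_zero] at this
      exact this.eventually_lt_const (by norm_num)
    filter_upwards [hu] with n hun k
    obtain ⟨m, hm⟩ : ∃ m : ℕ, k ^ 2 = (m : ℤ) := ⟨(k ^ 2).toNat, by
        rw [Int.toNat_of_nonneg (sq_nonneg k)]⟩
    simp only [hm, zpow_natCast, norm_pow]
    apply pow_le_pow_left₀ (norm_nonneg _)
    rw [Real.norm_eq_abs, Real.norm_eq_abs, abs_of_pos (by norm_num : (0 : ℝ) < 1 / 2)]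
    exact hun.le

lemma qP_summable (a : ℝ) {q : ℝ} (hq : |q| < 1) : Summable (fun n : ℕ => ‖-(a * q ^ n)‖) := by
  have := (summable_geometric_of_lt_one (abs_nonneg q) hq).mul_left |a|
  refine this.congr fun n => ?_
  rw [norm_neg, norm_mul, norm_pow, Real.norm_eq_abs, Real.norm_eq_abs]

lemma qP_mult (a : ℝ) {q : ℝ} (hq : |q| < 1) : Multipliable (fun n : ℕ => 1 - a * q ^ n) := by
  have := multipliable_one_add_of_summable (qP_summable a hq)
  simpa only [← sub_eq_add_neg] using this

lemma qP_tendsto (a : ℝ) {q : ℝ} (hq : |q| < 1) :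
    Tendsto (fun n : ℕ => ∏ i ∈ Finset.range n, (1 - a * q ^ i)) atTop (𝓝 (qPoch a q)) :=
  (qP_mult a hq).hasProd.tendsto_prod_nat

lemma qP_ne_zero {a q : ℝ} (ha : |a| < 1) (hq : |q| < 1) : qPoch a q ≠ 0 := by
  have := tprod_one_add_ne_zero_of_summable (f := fun n : ℕ => -(a * q ^ n)) ?_ (qP_summable a hq)
  · simpa only [← sub_eq_add_neg, qPoch] using this
  · intro n h
    have h1 : a * q ^ n = 1 := by linarith
    have h2 : |a * q ^ n| < 1 := by
      rw [abs_mul, abs_pow]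
      calc |a| * |q| ^ n ≤ |a| * 1 := by
            gcongr
            exact pow_le_one₀ (abs_nonneg q) hq.le
        _ < 1 := by linarith
    rw [h1] at h2
    simp at h2

lemma qP_shift (a : ℝ) {q : ℝ} (hq : |q| < 1) : qPoch a q = (1 - a) * qPoch (a * q) q := by
  unfold qPoch
  have h := qP_mult (a * q) hq
  have h2 : (fun n : ℕ => 1 - a * q * q ^ n) = fun n : ℕ => 1 - a * q ^ (n + 1) := by
    ext n; ring
  rw [h2] at h ⊢
  have h3 := tprod_eq_zero_mul' (f := fun n : ℕ => 1 - a * q ^ n) h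
  rw [h3, pow_zero, mul_one]

/-- Finite `(q;q)_n`. -/
noncomputable def qf (q : ℝ) (n : ℕ) : ℝ := ∏ i ∈ Finset.range n, (1 - q * q ^ i)

lemma qf_succ (q : ℝ) (n : ℕ) : qf q (n + 1) = qf q n * (1 - q * q ^ n) := by
  unfold qf; rw [Finset.prod_range_succ]

lemma qf_fac {q : ℝ} (h0 : 0 < q) (h1 : q < 1) (i : ℕ) :
    0 < 1 - q * q ^ i ∧ 1 - q * q ^ i ≤ 1 := by
  have h2 : q ^ i ≤ 1 := pow_le_one₀ h0.le h1.le
  have h3 : 0 < q ^ i := by positivity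
  constructor
  · nlinarith
  · nlinarith

lemma qf_pos {q : ℝ} (h0 : 0 < q) (h1 : q < 1) (n : ℕ) : 0 < qf q n :=
  Finset.prod_pos fun i _ => (qf_fac h0 h1 i).1

lemma qf_le_one {q : ℝ} (h0 : 0 < q) (h1 : q < 1) (n : ℕ) : qf q n ≤ 1 :=
  Finset.prod_le_one (fun i _ => (qf_fac h0 h1 i).1.le) fun i _ => (qf_fac h0 h1 i).2

lemma qf_ge {q : ℝ} (h0 : 0 < q) (h1 : q < 1) (n : ℕ) : qPoch q q ≤ qf q n := by
  have ha : Antitone (qf q) := antitone_nat_of_succ_le fun n => by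
    rw [qf_succ]
    exact mul_le_of_le_one_right (qf_pos h0 h1 n).le (qf_fac h0 h1 n).2
  exact ha.le_of_tendsto (qP_tendsto q (by rwa [abs_of_pos h0])) n

lemma qQ_pos {q : ℝ} (h0 : 0 < q) (h1 : q < 1) : 0 < qPoch q q := by
  have hq : |q| < 1 := by rwa [abs_of_pos h0]
  refine lt_of_le_of_ne ?_ (qP_ne_zero hq hq).symm
  exact ge_of_tendsto' (qP_tendsto q hq) fun n => (qf_pos h0 h1 n).le

/-- Reciprocal of `(q;q)_m`, extended by zero to negative `m`. -/
noncomputable def gz (q : ℝ) (m : ℤ) : ℝ := if 0 ≤ m then (qf q m.toNat)⁻¹ else 0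

lemma gz_nonneg {q : ℝ} (h0 : 0 < q) (h1 : q < 1) (m : ℤ) : 0 ≤ gz q m := by
  unfold gz
  split_ifs
  · exact (inv_pos.2 (qf_pos h0 h1 _)).le
  · exact le_rfl

lemma gz_le {q : ℝ} (h0 : 0 < q) (h1 : q < 1) (m : ℤ) : gz q m ≤ (qPoch q q)⁻¹ := by
  have hQ := qQ_pos h0 h1
  unfold gz
  split_ifs
  · exact inv_anti₀ hQ (qf_ge h0 h1 _)
  · positivity

lemma gz_rec {q : ℝ} (h0 : 0 < q) (h1 : q < 1) (m : ℤ) : gz q (m - 1) = (1 - q ^ m) * gz q m := by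
  unfold gz
  rcases lt_trichotomy m 0 with h | h | h
  · rw [if_neg (by omega), if_neg (by omega), mul_zero]
  · subst h; simp
  · obtain ⟨n, rfl⟩ : ∃ n : ℕ, m = (n : ℤ) + 1 := ⟨(m - 1).toNat, by omega⟩
    rw [if_pos (by omega), if_pos (by omega)]
    rw [show ((n : ℤ) + 1 - 1).toNat = n by omega, show ((n : ℤ) + 1).toNat = n + 1 by omega,
      qf_succ]
    have h2 := (qf_fac h0 h1 n).1.ne'
    have h3 := (qf_pos h0 h1 n).ne'
    rw [show q ^ ((n : ℤ) + 1) = q * q ^ n by rw [zpow_add_one₀ h0.ne', zpow_natCast, mul_comm]]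
    field_simp

lemma gz_tendsto {q : ℝ} (h0 : 0 < q) (h1 : q < 1) (k : ℤ) :
    Tendsto (fun n : ℕ => gz q ((n : ℤ) + k)) atTop (𝓝 (qPoch q q)⁻¹) := by
  have hq : |q| < 1 := by rwa [abs_of_pos h0]
  have hl : Tendsto (fun n : ℕ => ((n : ℤ) + k).toNat) atTop atTop := by
    rw [tendsto_atTop]
    intro b
    filter_upwards [eventually_ge_atTop (b + k.natAbs)] with n hn
    omega
  have h := ((qP_tendsto q hq).inv₀ (qP_ne_zero hq hq)).comp hl
  refine h.congr' ?_
  filter_upwards [eventually_ge_atTop k.natAbs] with n hn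
  unfold gz
  rw [if_pos (by omega)]
  rfl

/-- Terms of the finite triple product. -/
noncomputable def jt (p : ℝ) (n : ℕ) (k : ℤ) : ℝ :=
  qf (p ^ 2) (2 * n) * gz (p ^ 2) ((n : ℤ) + -k) * gz (p ^ 2) ((n : ℤ) + k) * p ^ (k ^ 2)

lemma sq_pos_lt {p : ℝ} (h0 : p ≠ 0) (h1 : |p| < 1) : 0 < p ^ 2 ∧ p ^ 2 < 1 :=
  ⟨by positivity, by rw [← sq_abs]; exact pow_lt_one₀ (abs_nonneg p) h1 (by norm_num)⟩

lemma jt_rec {p : ℝ} (h0 : p ≠ 0) (h1 : |p| < 1) (n : ℕ) (k : ℤ) :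
    jt p (n + 1) k = (1 + (p * (p ^ 2) ^ n) ^ 2) * jt p n k
      + p * (p ^ 2) ^ n * (jt p n (k - 1) + jt p n (k + 1)) := by
  obtain ⟨q0, q1⟩ := sq_pos_lt h0 h1
  unfold jt
  set q := p ^ 2 with hq
  set A := gz q ((n : ℤ) + 1 - k) with hA
  set B := gz q ((n : ℤ) + 1 + k) with hB
  have hy0 : q ^ k ≠ 0 := zpow_ne_zero _ q0.ne'
  have e1 : gz q (((n + 1 : ℕ) : ℤ) + -k) = A := by rw [hA]; congr 1
  have e2 : gz q (((n + 1 : ℕ) : ℤ) + k) = B := by rw [hB]; congr 1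
  have e3 : gz q ((n : ℤ) + -k) = (1 - q * q ^ n / q ^ k) * A := by
    rw [hA, show (n : ℤ) + -k = ((n : ℤ) + 1 - k) - 1 by ring, gz_rec q0 q1,
      zpow_sub₀ q0.ne', zpow_add_one₀ q0.ne', zpow_natCast, mul_comm q]
  have e4 : gz q ((n : ℤ) + k) = (1 - q * q ^ n * q ^ k) * B := by
    rw [hB, show (n : ℤ) + k = ((n : ℤ) + 1 + k) - 1 by ring, gz_rec q0 q1,
      zpow_add₀ q0.ne', zpow_add_one₀ q0.ne', zpow_natCast, mul_comm q]
  have e5 : gz q ((n : ℤ) + (k - 1)) = (1 - q ^ n * q ^ k) * ((1 - q * q ^ n * q ^ k) * B) := by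
    rw [← e4, show (n : ℤ) + (k - 1) = ((n : ℤ) + k) - 1 by ring, gz_rec q0 q1,
      zpow_add₀ q0.ne', zpow_natCast]
  have e6 : gz q ((n : ℤ) + -(k + 1)) = (1 - q ^ n / q ^ k) * ((1 - q * q ^ n / q ^ k) * A) := by
    rw [← e3, show (n : ℤ) + -(k + 1) = ((n : ℤ) + -k) - 1 by ring, gz_rec q0 q1,
      zpow_add₀ q0.ne', zpow_natCast, zpow_neg, div_eq_mul_inv]
  have e7 : gz q ((n : ℤ) + -(k - 1)) = A := by rw [hA]; congr 1; ring
  have e8 : gz q ((n : ℤ) + (k + 1)) = B := by rw [hB]; congr 1; ring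
  have hyk : q ^ k = p ^ (2 * k) := by rw [hq, ← zpow_natCast p 2, ← zpow_mul]; rfl
  have e9 : p ^ ((k - 1) ^ 2) = p ^ (k ^ 2) * p / q ^ k := by
    rw [hyk, ← zpow_add_one₀ h0, ← zpow_sub₀ h0]; congr 1; ring
  have e10 : p ^ ((k + 1) ^ 2) = p ^ (k ^ 2) * p * q ^ k := by
    rw [hyk, ← zpow_add_one₀ h0, ← zpow_add₀ h0]; congr 1; ring
  have e11 : qf q (2 * (n + 1)) = qf q (2 * n) * (1 - q * (q ^ n) ^ 2) * (1 - q ^ 2 * (q ^ n) ^ 2) := by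
    rw [show 2 * (n + 1) = 2 * n + 1 + 1 by ring, qf_succ, qf_succ]
    ring
  rw [e1, e2, e3, e4, e5, e6, e7, e8, e9, e10, e11]
  have hpp : p * p = q := by rw [hq]; ring
  generalize q ^ k = y at *
  generalize q ^ n = x at *
  generalize p ^ (k ^ 2) = z at *
  generalize qf q (2 * n) = F at *
  clear_value A B
  clear hyk e1 e2 e3 e4 e5 e6 e7 e8 e9 e10 e11 hA hB
  clear_value q
  field_simp
  subst hq
  ring

lemma jt_bound {p : ℝ} (h0 : p ≠ 0) (h1 : |p| < 1) (n : ℕ) (k : ℤ) :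
    ‖jt p n k‖ ≤ (qPoch (p ^ 2) (p ^ 2))⁻¹ ^ 2 * ‖p ^ (k ^ 2)‖ := by
  obtain ⟨q0, q1⟩ := sq_pos_lt h0 h1
  unfold jt
  rw [norm_mul]
  gcongr
  have hQ := qQ_pos q0 q1
  rw [Real.norm_eq_abs, abs_of_nonneg (mul_nonneg (mul_nonneg (qf_pos q0 q1 _).le
    (gz_nonneg q0 q1 _)) (gz_nonneg q0 q1 _))]
  calc _ ≤ 1 * (qPoch (p ^ 2) (p ^ 2))⁻¹ * (qPoch (p ^ 2) (p ^ 2))⁻¹ := by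
        apply mul_le_mul _ (gz_le q0 q1 _) (gz_nonneg q0 q1 _) (by positivity)
        exact mul_le_mul (qf_le_one q0 q1 _) (gz_le q0 q1 _) (gz_nonneg q0 q1 _) (by positivity)
    _ = _ := by ring

lemma jt_summable {p : ℝ} (h0 : p ≠ 0) (h1 : |p| < 1) (n : ℕ) : Summable (jt p n) :=
  Summable.of_norm_bounded ((th_summable_norm h1).mul_left _) (jt_bound h0 h1 n)

lemma tsum_shift (f : ℤ → ℝ) (e : ℤ ≃ ℤ) : ∑' k, f (e k) = ∑' k, f k := e.tsum_eq f

lemma summable_shift (f : ℤ → ℝ) (hf : Summable f) (e : ℤ ≃ ℤ) : Summable (fun k => f (e k)) :=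
  hf.comp_injective e.injective

lemma jt_sum {p : ℝ} (h0 : p ≠ 0) (h1 : |p| < 1) (n : ℕ) :
    ∑' k, jt p n k = (∏ i ∈ Finset.range n, (1 - (-p) * (p ^ 2) ^ i)) ^ 2 := by
  induction n with
  | zero =>
    rw [tsum_eq_single 0]
    · simp [jt, gz, qf]
    · intro k hk
      unfold jt gz
      rcases lt_or_gt_of_ne hk with h | h
      · rw [if_neg (c := 0 ≤ ((0 : ℕ) : ℤ) + k) (by push_cast; omega)]; simp
      · rw [if_neg (c := 0 ≤ ((0 : ℕ) : ℤ) + -k) (by push_cast; omega)]; simp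
  | succ n ih =>
    have hs := jt_summable h0 h1 n
    have t1 : ∑' k, jt p n (k - 1) = ∑' k, jt p n k := tsum_shift (jt p n) (Equiv.subRight (1 : ℤ))
    have t2 : ∑' k, jt p n (k + 1) = ∑' k, jt p n k := tsum_shift (jt p n) (Equiv.addRight (1 : ℤ))
    have s1 : Summable (fun k => jt p n (k - 1)) := summable_shift (jt p n) hs (Equiv.subRight (1 : ℤ))
    have s2 : Summable (fun k => jt p n (k + 1)) := summable_shift (jt p n) hs (Equiv.addRight (1 : ℤ))
    have s3 := hs.mul_left (1 + (p * (p ^ 2) ^ n) ^ 2)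
    have s4 := (s1.add s2).mul_left (p * (p ^ 2) ^ n)
    have t3 := Summable.tsum_add s3 s4
    rw [tsum_mul_left, tsum_mul_left, Summable.tsum_add s1 s2, t1, t2, ih] at t3
    rw [tsum_congr (jt_rec h0 h1 n), t3, Finset.prod_range_succ]
    ring

lemma th_prod {p : ℝ} (h0 : p ≠ 0) (h1 : |p| < 1) :
    th p * (qPoch (p ^ 2) (p ^ 2))⁻¹ = qPoch (-p) (p ^ 2) ^ 2 := by
  obtain ⟨q0, q1⟩ := sq_pos_lt h0 h1
  have hq : |p ^ 2| < 1 := abs_sq_lt h1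
  have hQ := qQ_pos q0 q1
  have lim1 := (qP_tendsto (-p) hq).pow 2
  have lim2 := tendsto_tsum_of_dominated_convergence (𝓕 := atTop) (f := jt p)
    (g := fun k => (qPoch (p ^ 2) (p ^ 2))⁻¹ * p ^ (k ^ 2))
    ((th_summable_norm h1).mul_left ((qPoch (p ^ 2) (p ^ 2))⁻¹ ^ 2)) ?_
    (Eventually.of_forall fun n k => jt_bound h0 h1 n k)
  · rw [tsum_mul_left] at lim2
    have := tendsto_nhds_unique (lim2.congr (jt_sum h0 h1)) lim1
    rw [mul_comm]
    exact this
  · intro k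
    have l0 : Tendsto (fun n : ℕ => qf (p ^ 2) (2 * n)) atTop (𝓝 (qPoch (p ^ 2) (p ^ 2))) :=
      (qP_tendsto (p ^ 2) hq).comp (tendsto_id.const_mul_atTop' (by norm_num : 0 < 2))
    have := ((l0.mul (gz_tendsto q0 q1 (-k))).mul (gz_tendsto q0 q1 k)).mul_const (p ^ (k ^ 2))
    rwa [mul_inv_cancel₀ hQ.ne', one_mul] at this

lemma th_neg_pos {p : ℝ} (h0 : 0 < p) (h1 : p < 1) : 0 < th (-p) := by
  have ha : |(-p)| < 1 := by rwa [abs_neg, abs_of_pos h0]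
  have hp : |p| < 1 := by rwa [abs_of_pos h0]
  have h := th_prod (neg_ne_zero.2 h0.ne') ha
  rw [neg_sq, neg_neg] at h
  have hQ := qQ_pos (sq_pos_lt h0.ne' hp).1 (sq_pos_lt h0.ne' hp).2
  have h2 : 0 < qPoch p (p ^ 2) ^ 2 := by
    have := qP_ne_zero hp (abs_sq_lt hp)
    positivity
  rw [← h] at h2
  exact (pos_iff_pos_of_mul_pos h2).2 (inv_pos.2 hQ)

lemma agI_theta {q : ℝ} (h0 : 0 < q) (h1 : q < 1) :
    agI (th q ^ 2) (th (-q) ^ 2) = Real.pi / 2 := by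
  have hp : ∀ n : ℕ, 0 < q ^ (2 ^ n) ∧ q ^ (2 ^ n) < 1 := fun n =>
    ⟨by positivity, pow_lt_one₀ h0.le h1 (by positivity)⟩
  have hl : Tendsto (fun n : ℕ => q ^ (2 ^ n)) atTop (𝓝 0) :=
    (tendsto_pow_atTop_nhds_zero_of_lt_one h0.le h1).comp
      (tendsto_pow_atTop_atTop_of_one_lt (by norm_num : 1 < 2))
  have hl' : Tendsto (fun n : ℕ => -q ^ (2 ^ n)) atTop (𝓝 0) := by simpa using hl.neg
  have key := agI_limit (fun n => th (q ^ (2 ^ n)) ^ 2) (fun n => th (-q ^ (2 ^ n)) ^ 2)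
    (fun n => pow_pos (th_pos (hp n).1 (hp n).2) 2)
    (fun n => pow_pos (th_neg_pos (hp n).1 (hp n).2) 2) ?_ ?_
    (by simpa using (th_tendsto _ hl).pow 2) (by simpa using (th_tendsto _ hl').pow 2)
  · simpa using key
  · intro n
    obtain ⟨p0, p1⟩ := hp n
    rw [pow_succ 2 n, pow_mul]
    generalize q ^ 2 ^ n = p at *
    have e1 := th_sq p0.ne' (by rwa [abs_of_pos p0])
    have e2 := th_sq (p := -p) (neg_ne_zero.2 p0.ne') (by rwa [abs_neg, abs_of_pos p0])
    rw [neg_sq] at e2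
    rw [e1, e2]; ring
  · intro n
    obtain ⟨p0, p1⟩ := hp n
    rw [pow_succ 2 n, pow_mul]
    generalize q ^ 2 ^ n = p at *
    have e1 := th_mul p0.ne' (by rwa [abs_of_pos p0])
    have := th_pos p0 p1
    have := th_neg_pos p0 p1
    rw [← mul_pow, Real.sqrt_sq (by positivity), e1]

lemma rexp_int_mul (x : ℝ) (n : ℤ) : Real.exp (n * x) = Real.exp x ^ n := by
  rw [mul_comm, Real.exp_mul, Real.rpow_intCast]

lemma th_exp (s : ℝ) : th (Real.exp (-Real.pi * s))
    = ∑' n : ℤ, Real.exp (-Real.pi * s * (n : ℝ) ^ 2) := by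
  unfold th
  apply tsum_congr
  intro n
  rw [← rexp_int_mul]
  congr 1
  push_cast; ring

lemma th_func {s : ℝ} (hs : 0 < s) :
    th (Real.exp (-Real.pi * s⁻¹)) = Real.sqrt s * th (Real.exp (-Real.pi * s)) := by
  rw [th_exp, th_exp, Real.tsum_exp_neg_mul_int_sq hs, ← Real.sqrt_eq_rpow, ← mul_assoc,
    mul_one_div_cancel (Real.sqrt_pos.2 hs).ne', one_mul]
  rfl

lemma th_func_neg {s : ℝ} (hs : 0 < s) :
    th (-Real.exp (-Real.pi * s⁻¹))
      = Real.sqrt s * (Real.exp (-Real.pi * s / 4) * tt (Real.exp (-Real.pi * s))) := by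
  have hs' : 0 < s⁻¹ := inv_pos.2 hs
  have key := Complex.tsum_exp_neg_quadratic (a := ((s⁻¹ : ℝ) : ℂ)) (by simpa using hs')
    (Complex.I / 2)
  have hL : ∀ n : ℤ, Complex.exp (-Real.pi * ((s⁻¹ : ℝ) : ℂ) * n ^ 2
      + 2 * Real.pi * (Complex.I / 2) * n)
      = (((-Real.exp (-Real.pi * s⁻¹)) ^ (n ^ 2) : ℝ) : ℂ) := by
    intro n
    rw [neg_zpow_sq, ← rexp_int_mul, Complex.exp_add,
      show 2 * Real.pi * (Complex.I / 2) * n = n * (Real.pi * Complex.I) by ring,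
      Complex.exp_int_mul, Complex.exp_pi_mul_I]
    push_cast
    rw [mul_comm]
    congr 2
    ring
  have hR : ∀ n : ℤ, Complex.exp (-Real.pi / ((s⁻¹ : ℝ) : ℂ) * (n + Complex.I * (Complex.I / 2)) ^ 2)
      = ((Real.exp (-Real.pi * s / 4) * Real.exp (-Real.pi * s) ^ ((-n) ^ 2 + (-n)) : ℝ) : ℂ) := by
    intro n
    rw [← rexp_int_mul, ← Real.exp_add]
    push_cast
    congr 1
    rw [show Complex.I * (Complex.I / 2) = -1 / 2 by
      rw [← mul_div_assoc, Complex.I_mul_I], div_inv_eq_mul]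
    ring
  rw [tsum_congr hL, tsum_congr hR, ← Complex.ofReal_tsum, ← Complex.ofReal_tsum,
    show (1 / 2 : ℂ) = ((1 / 2 : ℝ) : ℂ) by push_cast; rfl,
    ← Complex.ofReal_cpow hs'.le, ← Complex.ofReal_one, ← Complex.ofReal_div,
    ← Complex.ofReal_mul, Complex.ofReal_inj, tsum_mul_left] at key
  have e1 : ∑' n : ℤ, Real.exp (-Real.pi * s) ^ ((-n) ^ 2 + (-n)) = tt (Real.exp (-Real.pi * s)) :=
    tsum_shift (fun n : ℤ => Real.exp (-Real.pi * s) ^ (n ^ 2 + n)) (Equiv.neg ℤ)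
  rw [e1, ← Real.sqrt_eq_rpow, Real.sqrt_inv, one_div, inv_inv] at key
  exact key

lemma Kint_strict {x y : ℝ} (h0 : 0 ≤ x) (hxy : x < y) (h1 : y < 1) : Kint x < Kint y := by
  have hy : 0 < 1 - y ^ 2 := by nlinarith
  have hx : 1 - y ^ 2 < 1 - x ^ 2 := by nlinarith
  rw [Kint_eq_agI x (by linarith), Kint_eq_agI y hy.le]
  exact agI_strict one_pos (Real.sqrt_pos.2 hy) (Real.sqrt_lt_sqrt hy.le hx)

/-- Uniqueness of the singular modulus. -/
lemma modulus_unique {s k l : ℝ} (hs : 0 < s) (hk0 : 0 < k) (hk1 : k < 1) (hl0 : 0 < l)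
    (hl1 : l < 1) (hk : Kint (Real.sqrt (1 - k ^ 2)) = s * Kint k)
    (hl : Kint (Real.sqrt (1 - l ^ 2)) = s * Kint l) : ¬ k < l := by
  intro h
  have h1 := Kint_strict hk0.le h hl1
  have h2 : Real.sqrt (1 - l ^ 2) < Real.sqrt (1 - k ^ 2) :=
    Real.sqrt_lt_sqrt (by nlinarith) (by nlinarith)
  have h3 : Real.sqrt (1 - k ^ 2) < 1 := by
    rw [Real.sqrt_lt' one_pos]; nlinarith
  have h4 := Kint_strict (Real.sqrt_nonneg _) h2 h3
  nlinarith

/-- The theta modulus. -/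
lemma modulus_eq {s k : ℝ} (hs : 0 < s) (hk0 : 0 < k) (hk1 : k < 1)
    (hk : Kint (Real.sqrt (1 - k ^ 2)) = s * Kint k) {p : ℝ}
    (hp : p = Real.exp (-Real.pi * s / 2)) :
    (1 + k) / (1 - k) = th p ^ 2 / th (-p) ^ 2 := by
  have p0 : 0 < p := hp ▸ Real.exp_pos _
  have p1 : p < 1 := by
    rw [hp, Real.exp_lt_one_iff]
    have := mul_pos Real.pi_pos hs
    linarith
  have pa : |p| < 1 := by rwa [abs_of_pos p0]
  obtain ⟨q0, q1⟩ := sq_pos_lt p0.ne' pa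
  have hq : p ^ 2 = Real.exp (-Real.pi * s) := by
    rw [hp, ← Real.exp_nat_mul]; congr 1; push_cast; ring
  set q := p ^ 2 with hqd
  have e1 := th_sq p0.ne' pa
  have e2 := th_sq (p := -p) (neg_ne_zero.2 p0.ne') (by rwa [abs_neg])
  have e3 := th_mul p0.ne' pa
  rw [neg_sq] at e2
  rw [← hqd] at e1 e2 e3
  have X0 := th_pos p0 p1
  have Y0 := th_neg_pos p0 p1
  have T0 := th_pos q0 q1
  have U0 := th_neg_pos q0 q1
  have W0 := tt_pos q0 q1
  set T := th q with hT
  set W := tt q with hW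
  set l := p * W ^ 2 / T ^ 2 with hl
  have hlT : l * T ^ 2 = p * W ^ 2 := by rw [hl]; field_simp
  have l0 : 0 < l := by positivity
  clear_value l
  have l1 : l < 1 := by
    rw [hl, div_lt_one (by positivity)]
    have : 0 < th (-p) ^ 2 := by positivity
    linarith
  have hl2 : 0 < 1 - l ^ 2 := by nlinarith
  -- complementary modulus
  have hc : Real.sqrt (1 - l ^ 2) = th (-q) ^ 2 / T ^ 2 := by
    rw [show 1 - l ^ 2 = (th (-q) ^ 2 / T ^ 2) ^ 2 by
      rw [div_pow, eq_div_iff (by positivity), ← e3, mul_pow, e1, e2]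
      linear_combination (-(l * T ^ 2 + p * W ^ 2)) * hlT]
    exact Real.sqrt_sq (by positivity)
  have K1 : Kint l = T ^ 2 * (Real.pi / 2) := by
    rw [Kint_eq_agI l hl2.le, hc, ← agI_theta q0 q1, ← hT]
    have := agI_smul (a := T ^ 2) (b := th (-q) ^ 2) (c := (T ^ 2)⁻¹) (by positivity)
    rw [inv_inv, inv_mul_cancel₀ (by positivity), inv_mul_eq_div] at this
    exact this
  have K2 : Kint (Real.sqrt (1 - l ^ 2)) = s * (T ^ 2 * (Real.pi / 2)) := by
    have h2 : 1 - Real.sqrt (1 - l ^ 2) ^ 2 = l ^ 2 := by rw [Real.sq_sqrt hl2.le]; ring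
    rw [Kint_eq_agI _ (by rw [h2]; positivity), h2, Real.sqrt_sq l0.le]
    set q' := Real.exp (-Real.pi * s⁻¹) with hq'
    have f0 : 0 < q' := Real.exp_pos _
    have f1 : q' < 1 := by
      rw [hq', Real.exp_lt_one_iff]
      have := mul_pos Real.pi_pos (inv_pos.2 hs)
      linarith
    have g1 : th q' ^ 2 = s * T ^ 2 := by
      rw [hq', th_func hs, ← hq, mul_pow, Real.sq_sqrt hs.le]
    have g2 : th (-q') ^ 2 = s * (p * W ^ 2) := by
      rw [hq', th_func_neg hs, ← hq, mul_pow, Real.sq_sqrt hs.le, mul_pow, ← hW]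
      congr 2
      rw [hp, ← Real.exp_nat_mul]; congr 1; push_cast; ring
    have := agI_smul (a := 1) (b := l) (c := s * T ^ 2) (by positivity)
    rw [mul_one, mul_assoc, mul_comm (T ^ 2) l, hlT, ← g1, ← g2, agI_theta f0 f1, g1] at this
    rw [← mul_assoc, this, ← mul_assoc, mul_inv_cancel₀ (by positivity), one_mul]
  have hkl : k = l := by
    have hL : Kint (Real.sqrt (1 - l ^ 2)) = s * Kint l := by rw [K2, K1]
    exact le_antisymm (not_lt.1 (modulus_unique hs l0 l1 hk0 hk1 hL hk))
      (not_lt.1 (modulus_unique hs hk0 hk1 l0 l1 hk hL))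
  rw [hkl, e1, e2, ← hlT]
  have : 1 - l ≠ 0 := by linarith
  rw [show T ^ 2 + l * T ^ 2 = (1 + l) * T ^ 2 by ring,
    show T ^ 2 + -p * W ^ 2 = (1 - l) * T ^ 2 by linear_combination hlT]
  rw [mul_div_mul_right _ _ (by positivity)]

lemma exp_arctanh {x : ℝ} (h0 : 0 ≤ x) (h1 : x < 1) :
    Real.exp (2 * arctanh x) = (1 + x) / (1 - x) := by
  unfold arctanh
  rw [mul_div_cancel₀ _ two_ne_zero, Real.exp_log]
  exact div_pos (by linarith) (by linarith)

/-- Equation (25): for `q = e^{-π√r}` and every integer `ν ≥ 0`,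
`((-q^{ν+1/2};q)_∞/(q^{ν+1/2};q)_∞)² = exp(arctanh(k_r) - 4 ∑_{j=0}^{ν-1} arctanh(q^{j+1/2}))`. -/
theorem stmt_14 (r : ℝ) (hr : 0 < r) (q : ℝ) (hq : q = Real.exp (-Real.pi * Real.sqrt r))
    (k : ℝ) (hk0 : 0 < k) (hk1 : k < 1)
    (hK : Kint (Real.sqrt (1 - k ^ 2)) = Real.sqrt r * Kint k) (ν : ℕ) :
    (qPoch (-(q ^ ((ν : ℝ) + 1 / 2))) q / qPoch (q ^ ((ν : ℝ) + 1 / 2)) q) ^ 2 =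
      Real.exp (arctanh k - 4 * ∑ j ∈ Finset.range ν, arctanh (q ^ ((j : ℝ) + 1 / 2))) := by
  have hs : 0 < Real.sqrt r := Real.sqrt_pos.2 hr
  have q0 : 0 < q := hq ▸ Real.exp_pos _
  have q1 : q < 1 := by
    rw [hq, Real.exp_lt_one_iff]
    have := mul_pos Real.pi_pos hs
    linarith
  have qa : |q| < 1 := by rwa [abs_of_pos q0]
  induction ν with
  | zero =>
    set p := Real.exp (-Real.pi * Real.sqrt r / 2) with hp
    have p0 : 0 < p := Real.exp_pos _
    have hpq : p ^ 2 = q := by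
      rw [hp, hq, ← Real.exp_nat_mul]; congr 1; push_cast; ring
    have p1 : p < 1 := by nlinarith
    have pa : |p| < 1 := by rwa [abs_of_pos p0]
    have hh : q ^ (((0 : ℕ) : ℝ) + 1 / 2) = p := by
      rw [Nat.cast_zero, zero_add, ← Real.sqrt_eq_rpow, ← hpq, Real.sqrt_sq p0.le]
    rw [hh, Finset.sum_range_zero, mul_zero, sub_zero]
    have m := modulus_eq hs hk0 hk1 hK hp
    have t1 := th_prod p0.ne' pa
    have t2 := th_prod (p := -p) (neg_ne_zero.2 p0.ne') (by rwa [abs_neg])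
    rw [neg_sq, neg_neg] at t2
    rw [hpq] at t1 t2
    have hQ := qQ_pos q0 q1
    rw [div_pow, ← t1, ← t2, mul_div_mul_right _ _ (by positivity)]
    have hX := th_pos p0 p1
    have hY := th_neg_pos p0 p1
    rw [← exp_arctanh hk0.le hk1, ← div_pow] at m
    rw [show 2 * arctanh k = ((2 : ℕ) : ℝ) * arctanh k by push_cast; ring, Real.exp_nat_mul] at m
    exact ((pow_left_inj₀ (Real.exp_pos _).le (by positivity) two_ne_zero).1 m).symm
  | succ ν ih =>
    set x := q ^ ((ν : ℝ) + 1 / 2) with hx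
    have x0 : 0 < x := Real.rpow_pos_of_pos q0 _
    have x1 : x < 1 := Real.rpow_lt_one q0.le q1 (by positivity)
    have hxs : q ^ (((ν + 1 : ℕ) : ℝ) + 1 / 2) = x * q := by
      rw [hx, ← Real.rpow_add_one q0.ne']; congr 1; push_cast; ring
    have s1 := qP_shift x qa
    have s2 := qP_shift (-x) qa
    rw [hxs, Finset.sum_range_succ, ← hx, mul_add, ← sub_sub, Real.exp_sub, ← ih,
      show 4 * arctanh x = ((2 : ℕ) : ℝ) * (2 * arctanh x) by push_cast; ring, Real.exp_nat_mul,
      exp_arctanh x0.le x1, s1, s2, neg_mul]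
    have h1 : 1 - x ≠ 0 := by linarith
    have h2 : 1 + x ≠ 0 := by linarith
    have h3 : qPoch (x * q) q ≠ 0 := by
      apply qP_ne_zero _ qa
      rw [abs_of_pos (by positivity)]
      nlinarith
    rw [sub_neg_eq_add]
    field_simp
end
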